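/- arXiv:1309.2776 — 2 statements merged into one kernel-verified Lean document; each statement's English description precedes it below -/
import Mathlib

section
/- Let S = K[x_1,...,x_n] over a field K, and let I be a graded ideal of S containing a homogeneous regular sequence f_1,...,f_t with deg(f_i) = a_i, where a_1 ≤ ... ≤ a_t. Suppose that for every d ≥ 0 there exists a graded ideal L_d of S whose degree-d and degree-(d+1) components contain those of the ideal (x_1^{a_1},...,x_t^{a_t}), such that dim_K (S/L_d)_d = dim_K (S/I)_d and dim_K (S/L_d)_{d+1} ≥ dim_K (S/I)_{d+1}. Then there exists a graded ideal J of S containing x_1^{a_1},...,x_t^{a_t} with the same Hilbert function as I, i.e. dim_K (S/J)_d = dim_K (S/I)_d for all d ≥ 0. -/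
set_option synthInstance.maxHeartbeats 1000000
set_option maxHeartbeats 1000000

open MvPolynomial

/-- `dim_K (S/I)_d`, the Hilbert function of `S/I` in degree `d`:
the `K`-dimension of `S_d / I_d`. -/
noncomputable def hilbertFn {n : ℕ} (K : Type*) [Field K]
    (I : Ideal (MvPolynomial (Fin n) K)) (d : ℕ) : ℕ :=
  Module.finrank K
    (↥(homogeneousSubmodule (Fin n) K d) ⧸
      (Submodule.comap (homogeneousSubmodule (Fin n) K d).subtype
        (Submodule.restrictScalars K I)))

/-- A graded (homogeneous) ideal of `S = K[x₁,…,xₙ]`. -/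
def IsGradedIdeal {n : ℕ} {K : Type*} [Field K] (I : Ideal (MvPolynomial (Fin n) K)) : Prop :=
  ∀ f ∈ I, ∀ d : ℕ, homogeneousComponent d f ∈ I

namespace CLaux

/-- strict lexicographic order on exponent vectors -/
def LL {n : ℕ} (x y : Fin n → ℕ) : Prop := ∃ p, (∀ q < p, x q = y q) ∧ x p < y p

theorem LL_iff {n : ℕ} (x y : Fin n → ℕ) : LL x y ↔ toLex x < toLex y := Iff.rfl

theorem LL_tri {n : ℕ} (x y : Fin n → ℕ) : LL x y ∨ x = y ∨ LL y x := by
  rw [LL_iff, LL_iff]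
  rcases lt_trichotomy (toLex x) (toLex y) with h | h | h
  · exact Or.inl h
  · exact Or.inr (Or.inl (toLex.injective h))
  · exact Or.inr (Or.inr h)

theorem LL_irrefl {n : ℕ} (x : Fin n → ℕ) : ¬ LL x x := by
  rintro ⟨p, _, h⟩; exact lt_irrefl _ h

theorem LL_trans {n : ℕ} {x y z : Fin n → ℕ} (h : LL x y) (h' : LL y z) : LL x z := by
  rw [LL_iff] at *; exact h.trans h'

def up {n : ℕ} (x : Fin n → ℕ) (i : Fin n) : Fin n → ℕ := fun k => x k + if k = i then 1 else 0
def dn {n : ℕ} (x : Fin n → ℕ) (i : Fin n) : Fin n → ℕ := fun k => x k - if k = i then 1 else 0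

theorem up_same {n : ℕ} (x : Fin n → ℕ) (i : Fin n) : up x i i = x i + 1 := by simp [up]
theorem dn_same {n : ℕ} (x : Fin n → ℕ) (i : Fin n) : dn x i i = x i - 1 := by simp [dn]
theorem up_ne {n : ℕ} (x : Fin n → ℕ) {i k : Fin n} (h : k ≠ i) : up x i k = x k := by simp [up, h]
theorem dn_ne {n : ℕ} (x : Fin n → ℕ) {i k : Fin n} (h : k ≠ i) : dn x i k = x k := by simp [dn, h]
theorem le_up {n : ℕ} (x : Fin n → ℕ) (i k : Fin n) : x k ≤ up x i k := by simp [up]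
theorem dn_le {n : ℕ} (x : Fin n → ℕ) (i k : Fin n) : dn x i k ≤ x k := by simp [dn]
theorem up_dn {n : ℕ} (x : Fin n → ℕ) {i : Fin n} (h : 0 < x i) : up (dn x i) i = x := by
  funext k; by_cases hk : k = i
  · subst hk; rw [up_same, dn_same]; omega
  · rw [up_ne _ hk, dn_ne _ hk]
theorem dn_up {n : ℕ} (x : Fin n → ℕ) (i : Fin n) : dn (up x i) i = x := by
  funext k; by_cases hk : k = i
  · subst hk; rw [dn_same, up_same]; omega
  · rw [dn_ne _ hk, up_ne _ hk]
theorem up_inj {n : ℕ} {x y : Fin n → ℕ} {i : Fin n} (h : up x i = up y i) : x = y := by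
  rw [← dn_up x i, h, dn_up]
theorem sum_up {n : ℕ} (x : Fin n → ℕ) (i : Fin n) : ∑ k, up x i k = ∑ k, x k + 1 := by
  simp [up, Finset.sum_add_distrib]
theorem sum_dn {n : ℕ} (x : Fin n → ℕ) {i : Fin n} (h : 0 < x i) :
    ∑ k, dn x i k + 1 = ∑ k, x k := by
  rw [← sum_up (dn x i) i, up_dn x h]

open Classical in
/-- the fibre: vectors in the box, agreeing with `b` off `s`, of total degree `d` -/
noncomputable def Fib {n : ℕ} (c : Fin n → ℕ∞) (s : Finset (Fin n)) (b : Fin n → ℕ) (d : ℕ) :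
    Finset (Fin n → ℕ) :=
  ((Finset.univ : Finset (Fin n)).piAntidiag d).filter
    (fun x => (∀ i, (x i : ℕ∞) < c i) ∧ ∀ i, i ∉ s → x i = b i)

theorem mem_Fib {n : ℕ} {c : Fin n → ℕ∞} {s : Finset (Fin n)} {b : Fin n → ℕ} {d : ℕ}
    {x : Fin n → ℕ} : x ∈ Fib c s b d ↔
      ∑ k, x k = d ∧ (∀ i, (x i : ℕ∞) < c i) ∧ ∀ i, i ∉ s → x i = b i := by
  simp [Fib]

theorem Fib_up {n : ℕ} {c : Fin n → ℕ∞} {s : Finset (Fin n)} {b : Fin n → ℕ} {d : ℕ}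
    {x : Fin n → ℕ} {i : Fin n} (hx : x ∈ Fib c s b d) (hi : i ∈ s)
    (hc : ((x i + 1 : ℕ) : ℕ∞) < c i) : up x i ∈ Fib c s b (d+1) := by
  rw [mem_Fib] at *
  refine ⟨by rw [sum_up, hx.1], fun k => ?_, fun k hk => ?_⟩
  · by_cases h : k = i
    · subst h; rw [up_same]; exact hc
    · rw [up_ne _ h]; exact hx.2.1 k
  · rw [up_ne _ (by rintro rfl; exact hk hi)]; exact hx.2.2 k hk

theorem Fib_dn {n : ℕ} {c : Fin n → ℕ∞} {s : Finset (Fin n)} {b : Fin n → ℕ} {d : ℕ}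
    {x : Fin n → ℕ} {i : Fin n} (hx : x ∈ Fib c s b (d+1)) (hi : i ∈ s)
    (hc : 0 < x i) : dn x i ∈ Fib c s b d := by
  rw [mem_Fib] at *
  refine ⟨by have := sum_dn x hc; omega, fun k => ?_, fun k hk => ?_⟩
  · exact lt_of_le_of_lt (by exact_mod_cast dn_le x i k) (hx.2.1 k)
  · rw [dn_ne _ (by rintro rfl; exact hk hi)]; exact hx.2.2 k hk

theorem Fib_move {n : ℕ} {c : Fin n → ℕ∞} {s : Finset (Fin n)} {b : Fin n → ℕ} {d : ℕ}
    {x : Fin n → ℕ} {i j : Fin n} (hx : x ∈ Fib c s b d) (hi : i ∈ s) (hj : j ∈ s) (hij : j ≠ i)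
    (hc : ((x i + 1 : ℕ) : ℕ∞) < c i) (h0 : 0 < x j) : dn (up x i) j ∈ Fib c s b d :=
  Fib_dn (Fib_up hx hi hc) hj (by rwa [up_ne _ hij])

theorem Fib_sum {n : ℕ} {c : Fin n → ℕ∞} {s : Finset (Fin n)} {b : Fin n → ℕ} {d : ℕ}
    {x y : Fin n → ℕ} (hx : x ∈ Fib c s b d) (hy : y ∈ Fib c s b d) :
    ∑ k ∈ s, x k = ∑ k ∈ s, y k := by
  rw [mem_Fib] at *
  have h1 := Finset.sum_add_sum_compl s x
  have h2 := Finset.sum_add_sum_compl s y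
  have h3 : ∑ k ∈ sᶜ, x k = ∑ k ∈ sᶜ, y k := Finset.sum_congr rfl (fun k hk => by
    rw [hx.2.2 k (by simpa using hk), hy.2.2 k (by simpa using hk)])
  omega

theorem Fib_slice {n : ℕ} {c : Fin n → ℕ∞} {s : Finset (Fin n)} {b : Fin n → ℕ} {d : ℕ}
    {i : Fin n} (hi : i ∈ s) (k : ℕ) :
    Fib c (s.erase i) (Function.update b i k) d = (Fib c s b d).filter (fun x => x i = k) := by
  ext x
  simp only [mem_Fib, Finset.mem_filter, Finset.mem_erase, not_and]
  constructor
  · rintro ⟨h1, h2, h3⟩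
    refine ⟨⟨h1, h2, fun j hj => ?_⟩, ?_⟩
    · have : j ≠ i := by rintro rfl; exact hj hi
      simpa [this] using h3 j (fun _ => hj)
    · simpa using h3 i (fun h => absurd rfl h)
  · rintro ⟨⟨h1, h2, h3⟩, h4⟩
    refine ⟨h1, h2, fun j hj => ?_⟩
    by_cases h : j = i
    · subst h; simpa using h4
    · simpa [h] using h3 j (hj h)

def Seg {n : ℕ} (F C : Finset (Fin n → ℕ)) : Prop := C ⊆ F ∧ ∀ x ∈ C, ∀ y ∈ F, LL x y → y ∈ C

theorem Seg_nested {n : ℕ} {F C D : Finset (Fin n → ℕ)} (hC : Seg F C) (hD : Seg F D) :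
    C ⊆ D ∨ D ⊆ C := by
  by_contra! h
  obtain ⟨h1, h2⟩ := h
  obtain ⟨x, hx, hx'⟩ := Finset.not_subset.1 h1
  obtain ⟨y, hy, hy'⟩ := Finset.not_subset.1 h2
  rcases LL_tri x y with h | h | h
  · exact hy' (hC.2 x hx y (hD.1 hy) h)
  · subst h; exact hx' hy
  · exact hx' (hD.2 y hy x (hC.1 hx) h)

theorem Seg_sub {n : ℕ} {F C D : Finset (Fin n → ℕ)} (hC : Seg F C) (hD : Seg F D)
    (h : C.card ≤ D.card) : C ⊆ D := by
  rcases Seg_nested hC hD with h1 | h1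
  · exact h1
  · rw [Finset.eq_of_subset_of_card_le h1 h]

theorem Seg_exists {n : ℕ} (F : Finset (Fin n → ℕ)) (k : ℕ) (hk : k ≤ F.card) :
    ∃ C, Seg F C ∧ C.card = k := by
  induction k with
  | zero => exact ⟨∅, ⟨by simp, by simp⟩, rfl⟩
  | succ k ih =>
    obtain ⟨C, hC, hc⟩ := ih (by omega)
    have hne : (F \ C).Nonempty := by
      rw [Finset.sdiff_nonempty]; intro h
      have := Finset.card_le_card h; omega
    obtain ⟨m, hm, hmax⟩ := Finset.exists_max_image (F \ C) (fun x => toLex x) hne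
    rw [Finset.mem_sdiff] at hm
    refine ⟨insert m C, ⟨?_, ?_⟩, ?_⟩
    · intro x hx
      rcases Finset.mem_insert.1 hx with rfl | hx
      · exact hm.1
      · exact hC.1 hx
    · intro x hx y hy hxy
      rw [Finset.mem_insert]
      rcases Finset.mem_insert.1 hx with rfl | hx
      · right
        by_contra hyc
        have := hmax y (Finset.mem_sdiff.2 ⟨hy, hyc⟩)
        exact absurd hxy (not_lt.2 this)
      · right; exact hC.2 x hx y hy hxy
    · rw [Finset.card_insert_of_notMem hm.2, hc]

open Classical in
noncomputable def shadow {n : ℕ} (c : Fin n → ℕ∞) (s : Finset (Fin n)) (A : Finset (Fin n → ℕ)) :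
    Finset (Fin n → ℕ) :=
  ((A ×ˢ s).image (fun p => up p.1 p.2)).filter (fun y => ∀ i, (y i : ℕ∞) < c i)

theorem mem_shadow {n : ℕ} {c : Fin n → ℕ∞} {s : Finset (Fin n)} {A : Finset (Fin n → ℕ)}
    {y : Fin n → ℕ} : y ∈ shadow c s A ↔
      (∃ x ∈ A, ∃ i ∈ s, up x i = y) ∧ ∀ i, (y i : ℕ∞) < c i := by
  simp [shadow]; grind

theorem shadow_mono {n : ℕ} {c : Fin n → ℕ∞} {s : Finset (Fin n)} {A B : Finset (Fin n → ℕ)}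
    (h : A ⊆ B) : shadow c s A ⊆ shadow c s B := by
  intro y hy
  rw [mem_shadow] at *
  obtain ⟨⟨x, hx, i, hi, e⟩, h2⟩ := hy
  exact ⟨⟨x, h hx, i, hi, e⟩, h2⟩

theorem up_mem_shadow {n : ℕ} {c : Fin n → ℕ∞} {s : Finset (Fin n)} {A : Finset (Fin n → ℕ)}
    {b : Fin n → ℕ} {d : ℕ} (hA : A ⊆ Fib c s b d) {x : Fin n → ℕ} (hx : x ∈ A) {i : Fin n}
    (hi : i ∈ s) (hc : ((x i + 1 : ℕ) : ℕ∞) < c i) : up x i ∈ shadow c s A :=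
  mem_shadow.2 ⟨⟨x, hx, i, hi, rfl⟩, (mem_Fib.1 (Fib_up (hA hx) hi hc)).2.1⟩

theorem shadow_sub {n : ℕ} {c : Fin n → ℕ∞} {s : Finset (Fin n)} {A : Finset (Fin n → ℕ)}
    {b : Fin n → ℕ} {d : ℕ} (hA : A ⊆ Fib c s b d) : shadow c s A ⊆ Fib c s b (d+1) := by
  intro y hy
  obtain ⟨⟨x, hx, i, hi, rfl⟩, h2⟩ := mem_shadow.1 hy
  exact Fib_up (hA hx) hi (by simpa [up_same] using h2 i)

theorem shadow_Seg {n : ℕ} {c : Fin n → ℕ∞} {s : Finset (Fin n)} {C : Finset (Fin n → ℕ)}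
    {b : Fin n → ℕ} {d : ℕ} (hC : Seg (Fib c s b d) C) :
    Seg (Fib c s b (d+1)) (shadow c s C) := by
  refine ⟨shadow_sub hC.1, ?_⟩
  intro y hy z hz hyz
  have hyF := shadow_sub hC.1 hy
  obtain ⟨⟨x, hx, i, hi, rfl⟩, h2⟩ := mem_shadow.1 hy
  obtain ⟨p, hp, hpz⟩ := hyz
  have hxF := mem_Fib.1 (hC.1 hx)
  have hyF' := mem_Fib.1 hyF
  have hzF' := mem_Fib.1 hz
  have hps : p ∈ s := by
    by_contra h
    rw [hyF'.2.2 p h, hzF'.2.2 p h] at hpz; exact lt_irrefl _ hpz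
  -- it suffices to find j
  have key : ∀ j ∈ s, 0 < z j → ¬ LL (dn z j) x → z ∈ shadow c s C := by
    intro j hj h0 hn
    have hw := Fib_dn hz hj h0
    have hwC : dn z j ∈ C := by
      rcases LL_tri (dn z j) x with h | h | h
      · exact absurd h hn
      · rw [h]; exact hx
      · exact hC.2 x hx _ hw h
    exact mem_shadow.2 ⟨⟨_, hwC, j, hj, up_dn z h0⟩, hzF'.2.1⟩
  by_cases hj : ∃ j ∈ s, p < j ∧ 0 < z j
  · obtain ⟨j, hjs, hpj, h0⟩ := hj
    apply key j hjs h0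
    rintro ⟨q, hq, hqx⟩
    rcases lt_trichotomy q p with h | h | h
    · have h1 := hp q h
      have h3 := le_up x i q
      rw [dn_ne _ (by omega)] at hqx
      omega
    · subst h
      have h3 := le_up x i q
      rw [dn_ne _ (by omega)] at hqx
      omega
    · have h1 := hq p h
      have h3 := le_up x i p
      rw [dn_ne _ (by omega)] at h1
      omega
  · push Not at hj
    have h0 : 0 < z p := by omega
    apply key p hps h0
    rintro ⟨q, hq, hqx⟩
    rcases lt_trichotomy q p with h | h | h
    · have h1 := hp q h
      have h3 := le_up x i q
      rw [dn_ne _ (by omega)] at hqx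
      omega
    · subst h
      have h3 := le_up x i q
      rw [dn_same] at hqx
      omega
    · have hle : ∀ r ∈ Finset.univ, dn z p r ≤ x r := by
        intro r _
        rcases lt_trichotomy r q with h' | h' | h'
        · exact (hq r h').le
        · subst h'; exact hqx.le
        · by_cases hr : r ∈ s
          · have h5 := hj r hr (by omega)
            have := dn_le z p r
            omega
          · rw [dn_ne _ (by omega), hzF'.2.2 r hr, hxF.2.2 r hr]
      have hlt := Finset.sum_lt_sum hle ⟨q, Finset.mem_univ q, hqx⟩
      have := sum_dn z h0
      omega

/-- the Borel type property of compressed sets -/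
theorem star {n : ℕ} {c : Fin n → ℕ∞} {s : Finset (Fin n)} {A : Finset (Fin n → ℕ)}
    {b : Fin n → ℕ} {d : ℕ} (hA : A ⊆ Fib c s b d) (hs : 3 ≤ s.card)
    (hcomp : ∀ i ∈ s, ∀ x ∈ A, ∀ y ∈ Fib c s b d, x i = y i → LL x y → y ∈ A)
    {l : Fin n} (hl : l ∈ s) (hmax : ∀ j ∈ s, j ≤ l) (k : ℕ) :
    ∀ v ∈ A, ∀ u ∈ Fib c s b d, LL v u → u l ≤ v l → v l - u l = k → u ∈ A := by
  induction k with
  | zero => 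
    intro v hv u hu huv h1 h2
    exact hcomp l hl v hv u hu (by omega) huv
  | succ k ih =>
    intro v hv u hu huv h1 h2
    by_cases hsh : ∃ i ∈ s, v i = u i
    · obtain ⟨i, hi, e⟩ := hsh
      exact hcomp i hi v hv u hu e huv
    push Not at hsh
    obtain ⟨p, hp, hpu⟩ := huv
    have hvF := mem_Fib.1 (hA hv)
    have huF := mem_Fib.1 hu
    have hps : p ∈ s := by
      by_contra h
      rw [hvF.2.2 p h, huF.2.2 p h] at hpu; exact lt_irrefl _ hpu
    have hpl : p ≠ l := by rintro rfl; omega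
    have hpl' : p < l := lt_of_le_of_ne (hmax p hps) hpl
    by_cases hq : ∃ q ∈ s, q ≠ p ∧ q ≠ l ∧ v q < u q
    · obtain ⟨q, hqs, hqp, hql, hqv⟩ := hq
      have hql' : q < l := lt_of_le_of_ne (hmax q hqs) hql
      have hw : dn (up u l) q ∈ Fib c s b d := by
        apply Fib_move hu hl hqs hql _ (by omega)
        exact lt_of_le_of_lt (by exact_mod_cast (by omega : u l + 1 ≤ v l)) (hvF.2.1 l)
      have hqp' : p < q := by
        by_contra h
        have := hp q (by omega)
        omega
      have hwA : dn (up u l) q ∈ A := by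
        apply ih v hv _ hw
        · refine ⟨p, fun r hr => ?_, ?_⟩
          · rw [dn_ne _ (by omega), up_ne _ (by omega)]; exact hp r hr
          · rw [dn_ne _ (by omega), up_ne _ (by omega)]; exact hpu
        · rw [dn_ne _ hql.symm, up_same]; omega
        · rw [dn_ne _ hql.symm, up_same]; omega
      apply hcomp p hps _ hwA u hu
      · rw [dn_ne _ (by omega), up_ne _ (by omega)]
      · refine ⟨q, fun r hr => ?_, ?_⟩
        · rw [dn_ne _ (by omega), up_ne _ (by omega)]
        · rw [dn_same, up_ne _ hql]; omega
    · push Not at hq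
      obtain ⟨q, hq1⟩ : ((s.erase p).erase l).Nonempty := by
        rw [← Finset.card_pos, Finset.card_erase_of_mem (by simp [hl, hpl.symm]),
          Finset.card_erase_of_mem hps]
        omega
      simp only [Finset.mem_erase] at hq1
      obtain ⟨hql, hqp, hqs⟩ := hq1
      have hw : dn (up v p) l ∈ Fib c s b d := by
        apply Fib_move (hA hv) hps hl hpl.symm _ (by omega)
        exact lt_of_le_of_lt (by exact_mod_cast (by omega : v p + 1 ≤ u p)) (huF.2.1 p)
      have hwp : dn (up v p) l p = v p + 1 := by rw [dn_ne _ hpl, up_same]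
      have hwl : dn (up v p) l l = v l - 1 := by rw [dn_same, up_ne _ hpl.symm]
      have hwr : ∀ r, r ≠ p → r ≠ l → dn (up v p) l r = v r := fun r h h' => by
        rw [dn_ne _ h', up_ne _ h]
      have hwA : dn (up v p) l ∈ A := by
        apply hcomp q hqs v hv _ hw (hwr q hqp hql).symm
        refine ⟨p, fun r hr => (hwr r (by omega) (by omega)).symm, by omega⟩
      apply ih _ hwA u hu _ (by omega) (by omega)
      refine ⟨p, fun r hr => ?_, ?_⟩
      · rw [hwr r (by omega) (by omega)]; exact hp r hr
      · rw [hwp]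
        by_contra hcon
        have hle : ∀ r ∈ Finset.univ, u r ≤ dn (up v p) l r := by
          intro r _
          by_cases h : r = p
          · subst h; omega
          by_cases h' : r = l
          · subst h'; omega
          rw [hwr r h h']
          by_cases hr : r ∈ s
          · exact hq r hr h h'
          · rw [hvF.2.2 r hr, huF.2.2 r hr]
        have hlt := Finset.sum_lt_sum hle ⟨q, Finset.mem_univ q, by
          rw [hwr q hqp hql]
          exact lt_of_le_of_ne (hq q hqs hqp hql) (Ne.symm (hsh q hqs))⟩
        rw [(mem_Fib.1 hw).1, huF.1] at hlt
        exact lt_irrefl _ hlt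

open Classical in
theorem shadow_formula {n : ℕ} {c : Fin n → ℕ∞} {s : Finset (Fin n)} {A : Finset (Fin n → ℕ)}
    {b : Fin n → ℕ} {d : ℕ} (hA : A ⊆ Fib c s b d) {l : Fin n} (hl : l ∈ s)
    (hmax : ∀ j ∈ s, j ≤ l)
    (hstar : ∀ v ∈ A, ∀ u ∈ Fib c s b d, LL v u → u l ≤ v l → u ∈ A) :
    (shadow c s A).card = (shadow c (s.erase l) (A.filter (fun x => x l = 0))).card
      + (A.filter (fun x => ((x l + 1 : ℕ) : ℕ∞) < c l)).card := by
  have h2 : ((A.filter (fun x => ((x l + 1 : ℕ) : ℕ∞) < c l)).image (fun x => up x l)).card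
      = (A.filter (fun x => ((x l + 1 : ℕ) : ℕ∞) < c l)).card :=
    Finset.card_image_of_injective _ (fun x y h => up_inj h)
  rw [← h2, ← Finset.card_union_of_disjoint]
  · congr 1
    ext y
    rw [Finset.mem_union, mem_shadow, mem_shadow]
    simp only [Finset.mem_image, Finset.mem_filter, Finset.mem_erase]
    constructor
    · rintro ⟨⟨x, hx, i, hi, rfl⟩, hc⟩
      by_cases hil : i = l
      · subst hil
        right
        refine ⟨x, ⟨hx, ?_⟩, rfl⟩
        simpa [up_same] using hc i
      · have hil' : i < l := lt_of_le_of_ne (hmax i hi) hil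
        by_cases h0 : x l = 0
        · left; exact ⟨⟨x, ⟨hx, h0⟩, i, ⟨hil, hi⟩, rfl⟩, hc⟩
        · right
          have hw : dn (up x i) l ∈ Fib c s b d :=
            Fib_move (hA hx) hi hl (Ne.symm hil) (by simpa [up_same] using hc i) (by omega)
          have hul : up x i l = x l := up_ne _ (Ne.symm hil)
          refine ⟨dn (up x i) l, ⟨hstar x hx _ hw ?_ ?_, ?_⟩, up_dn _ (by omega)⟩
          · refine ⟨i, fun r hr => ?_, ?_⟩
            · rw [dn_ne _ (by omega), up_ne _ (by omega)]
            · rw [dn_ne _ hil, up_same]; omega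
          · rw [dn_same]; omega
          · rw [dn_same, hul, Nat.sub_add_cancel (by omega), ← hul]; exact hc l
    · rintro (⟨⟨x, ⟨hx, h0⟩, i, ⟨hil, hi⟩, rfl⟩, hc⟩ | ⟨x, ⟨hx, h0⟩, rfl⟩)
      · exact ⟨⟨x, hx, i, hi, rfl⟩, hc⟩
      · exact ⟨⟨x, hx, l, hl, rfl⟩, (mem_Fib.1 (Fib_up (hA hx) hl h0)).2.1⟩
  · rw [Finset.disjoint_left]
    intro y hy hy'
    rw [mem_shadow] at hy
    simp only [Finset.mem_image, Finset.mem_filter, Finset.mem_erase] at hy hy'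
    obtain ⟨⟨x, ⟨hx, h0⟩, i, ⟨hil, hi⟩, rfl⟩, hc⟩ := hy
    obtain ⟨z, _, hz⟩ := hy'
    have := congrFun hz l
    rw [up_same, up_ne _ (Ne.symm hil)] at this
    omega

open Classical in
theorem low_card {n : ℕ} {F A C : Finset (Fin n → ℕ)} (hA : A ⊆ F) (hC : Seg F C) {l : Fin n}
    (hstar : ∀ v ∈ A, ∀ u ∈ F, LL v u → u l ≤ v l → u ∈ A) (hcard : C.card ≤ A.card)
    (q : ℕ → Prop) (hq : ∀ i j, i ≤ j → q j → q i) :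
    (C.filter (fun x => q (x l))).card ≤ (A.filter (fun x => q (x l))).card := by
  by_cases h : ∃ u ∈ C, q (u l) ∧ u ∉ A
  · obtain ⟨u, hu, hqu, huA⟩ := h
    have h1 : A.filter (fun x => ¬ q (x l)) ⊆ C.filter (fun x => ¬ q (x l)) := by
      intro v hv
      rw [Finset.mem_filter] at *
      refine ⟨?_, hv.2⟩
      have hle : u l ≤ v l := by
        by_contra hlt
        exact hv.2 (hq _ _ (by omega) hqu)
      rcases LL_tri v u with h | h | h
      · exact absurd (hstar v hv.1 u (hC.1 hu) h hle) huA
      · rw [h]; exact hu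
      · exact hC.2 u hu v (hA hv.1) h
    have h2 := Finset.card_le_card h1
    have h3 := Finset.card_filter_add_card_filter_not (s := A) (fun x => q (x l))
    have h4 := Finset.card_filter_add_card_filter_not (s := C) (fun x => q (x l))
    omega
  · push Not at h
    apply Finset.card_le_card
    intro u hu
    rw [Finset.mem_filter] at *
    exact ⟨h u hu.1 hu.2, hu.2⟩

theorem seg_slice {n : ℕ} {c : Fin n → ℕ∞} {s : Finset (Fin n)} {C : Finset (Fin n → ℕ)}
    {b : Fin n → ℕ} {d : ℕ} {i : Fin n} (hi : i ∈ s) (hC : C ⊆ Fib c s b d)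
    (hcomp : ∀ x ∈ C, ∀ y ∈ Fib c s b d, x i = y i → LL x y → y ∈ C) (k : ℕ) :
    Seg (Fib c (s.erase i) (Function.update b i k) d) (C.filter (fun x => x i = k)) := by
  rw [Fib_slice hi]
  refine ⟨Finset.filter_subset_filter _ hC, ?_⟩
  intro x hx y hy hxy
  rw [Finset.mem_filter] at *
  exact ⟨hcomp x hx.1 y hy.1 (by omega) hxy, hy.2⟩

theorem CL_compressed {n : ℕ} {c : Fin n → ℕ∞} {s : Finset (Fin n)} {A C : Finset (Fin n → ℕ)}
    {b : Fin n → ℕ} {d : ℕ} (hA : A ⊆ Fib c s b d) (hs : 3 ≤ s.card)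
    (hcomp : ∀ i ∈ s, ∀ x ∈ A, ∀ y ∈ Fib c s b d, x i = y i → LL x y → y ∈ A)
    (hC : Seg (Fib c s b d) C) (hcard : C.card ≤ A.card) :
    (shadow c s C).card ≤ (shadow c s A).card := by
  classical
  have hne : s.Nonempty := by rw [← Finset.card_pos]; omega
  obtain ⟨l, hl, hmax⟩ : ∃ l ∈ s, ∀ j ∈ s, j ≤ l :=
    ⟨s.max' hne, s.max'_mem hne, fun j hj => s.le_max' j hj⟩
  have hstar : ∀ v ∈ A, ∀ u ∈ Fib c s b d, LL v u → u l ≤ v l → u ∈ A :=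
    fun v hv u hu h h' => star hA hs hcomp hl hmax _ v hv u hu h h' rfl
  rw [shadow_formula hA hl hmax hstar,
    shadow_formula hC.1 hl hmax (fun v hv u hu h _ => hC.2 v hv u hu h)]
  apply Nat.add_le_add
  · apply Finset.card_le_card
    apply shadow_mono
    apply Seg_sub (seg_slice hl hC.1 (fun x hx y hy _ h => hC.2 x hx y hy h) 0)
      (seg_slice hl hA (hcomp l hl) 0)
    have := low_card hA hC hstar hcard (fun k => k = 0) (fun i j h h' => by omega)
    convert this
  · have := low_card hA hC hstar hcard (fun k => ((k + 1 : ℕ) : ℕ∞) < c l)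
      (fun i j h h' => lt_of_le_of_lt (by exact_mod_cast (by omega : i + 1 ≤ j + 1)) h')
    convert this

theorem CL_small {n : ℕ} {c : Fin n → ℕ∞} {s : Finset (Fin n)} {A C : Finset (Fin n → ℕ)}
    {b : Fin n → ℕ} {d : ℕ} (hA : A ⊆ Fib c s b d) (hs : s.card ≤ 1)
    (hC : Seg (Fib c s b d) C) (hcard : C.card ≤ A.card) :
    (shadow c s C).card ≤ (shadow c s A).card := by
  have hsub : ∀ x ∈ Fib c s b d, ∀ y ∈ Fib c s b d, x = y := by
    intro x hx y hy
    have hsum := Fib_sum hx hy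
    rw [mem_Fib] at *
    funext k
    by_cases hk : k ∈ s
    · have : s = {k} := by
        apply Eq.symm
        apply Finset.eq_of_subset_of_card_le (by simpa using hk)
        simpa using hs
      rw [this] at hsum
      simpa using hsum
    · rw [hx.2.2 k hk, hy.2.2 k hk]
  apply Finset.card_le_card
  apply shadow_mono
  intro x hx
  have : 0 < A.card := lt_of_lt_of_le (Finset.card_pos.2 ⟨x, hx⟩) hcard
  obtain ⟨y, hy⟩ := Finset.card_pos.1 this
  rw [hsub x (hC.1 hx) y (hA hy)]; exact hy

theorem CL_two {n : ℕ} {c : Fin n → ℕ∞} (hc : Monotone c) {i j : Fin n} (hij : i < j)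
    {A C : Finset (Fin n → ℕ)}
    {b : Fin n → ℕ} {d : ℕ} (hA : A ⊆ Fib c {i, j} b d)
    (hC : Seg (Fib c {i, j} b d) C) (hcard : C.card ≤ A.card) :
    (shadow c {i, j} C).card ≤ (shadow c {i, j} A).card := by
  classical
  have hne : i ≠ j := hij.ne
  have hi : i ∈ ({i, j} : Finset (Fin n)) := by simp
  have hj : j ∈ ({i, j} : Finset (Fin n)) := by simp
  rcases C.eq_empty_or_nonempty with rfl | hCne
  · have : shadow c {i, j} (∅ : Finset (Fin n → ℕ)) = ∅ := by
      ext y; simp [mem_shadow]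
    simp [this]
  have hAne : A.Nonempty := by
    rw [← Finset.card_pos] at *; omega
  obtain ⟨x0, hx0⟩ := hCne
  obtain ⟨D, hD⟩ : ∃ D, ∀ x ∈ Fib c {i, j} b d, x i + x j = D := by
    refine ⟨x0 i + x0 j, fun x hx => ?_⟩
    have := Fib_sum hx (hC.1 hx0)
    rwa [Finset.sum_pair hne, Finset.sum_pair hne] at this
  have hext : ∀ d', ∀ x ∈ Fib c {i, j} b d', ∀ y ∈ Fib c {i, j} b d', x i = y i → x = y := by
    intro d' x hx y hy hxy
    have h1 := Fib_sum hx hy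
    rw [Finset.sum_pair hne, Finset.sum_pair hne] at h1
    funext k
    by_cases hk : k ∈ ({i, j} : Finset (Fin n))
    · simp only [Finset.mem_insert, Finset.mem_singleton] at hk
      rcases hk with rfl | rfl <;> omega
    · rw [(mem_Fib.1 hx).2.2 k hk, (mem_Fib.1 hy).2.2 k hk]
  have hui : ∀ x : Fin n → ℕ, up x i i = x i + 1 := fun x => up_same _ _
  have huj : ∀ x : Fin n → ℕ, up x j i = x i := fun x => up_ne _ hne
  have himj : ∀ B : Finset (Fin n → ℕ), (B.image (fun x => up x j)).card = B.card := fun B =>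
    Finset.card_image_of_injective _ (fun x y h => up_inj h)
  have himi : ∀ B : Finset (Fin n → ℕ), (B.image (fun x => up x i)).card = B.card := fun B =>
    Finset.card_image_of_injective _ (fun x y h => up_inj h)
  by_cases hDc : ((D + 1 : ℕ) : ℕ∞) < c i
  · have hDc' : ((D + 1 : ℕ) : ℕ∞) < c j := lt_of_lt_of_le hDc (hc hij.le)
    obtain ⟨m, hm, hmin⟩ := Finset.exists_min_image C (fun x => x i) ⟨x0, hx0⟩
    obtain ⟨M, hM, hmax⟩ := Finset.exists_max_image A (fun x => x i) hAne
    have h1 : shadow c {i, j} C ⊆ insert (up m j) (C.image (fun x => up x i)) := by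
      intro y hy
      have hyF := shadow_sub hC.1 hy
      obtain ⟨⟨x, hx, k, hk, rfl⟩, hyc⟩ := mem_shadow.1 hy
      rw [Finset.mem_insert, Finset.mem_image]
      simp only [Finset.mem_insert, Finset.mem_singleton] at hk
      rcases hk with rfl | rfl
      · right; exact ⟨x, hx, rfl⟩
      · by_cases hxm : x i = m i
        · left; rw [hext _ x (hC.1 hx) m (hC.1 hm) hxm]
        · right
          have hlt : m i < x i := lt_of_le_of_ne (hmin x hx) (Ne.symm hxm)
          have hw : dn (up x k) i ∈ Fib c {i, k} b d :=
            Fib_dn hyF hi (by rw [huj]; omega)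
          have hwi : dn (up x k) i i = x i - 1 := by rw [dn_same, huj]
          refine ⟨dn (up x k) i, ?_, up_dn _ (by rw [huj]; omega)⟩
          rcases LL_tri m (dn (up x k) i) with h | h | h
          · exact hC.2 m hm _ hw h
          · rw [← h]; exact hm
          · exfalso
            obtain ⟨p, hp, hpl⟩ := h
            rcases lt_trichotomy p i with h' | h' | h'
            · have hps : p ∉ ({i, k} : Finset (Fin n)) := by
                simp only [Finset.mem_insert, Finset.mem_singleton]; omega
              rw [(mem_Fib.1 hw).2.2 p hps, (mem_Fib.1 (hC.1 hm)).2.2 p hps] at hpl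
              exact lt_irrefl _ hpl
            · subst h'; omega
            · have h7 := hp i h'
              rw [hext _ _ hw m (hC.1 hm) h7] at hpl
              exact lt_irrefl _ hpl
    have h2 : insert (up M i) (A.image (fun x => up x j)) ⊆ shadow c {i, j} A := by
      intro y hy
      rw [Finset.mem_insert, Finset.mem_image] at hy
      rcases hy with rfl | ⟨x, hx, rfl⟩
      · apply up_mem_shadow hA hM hi
        have := hD M (hA hM)
        exact lt_of_le_of_lt (by exact_mod_cast (by omega : M i + 1 ≤ D + 1)) hDc
      · apply up_mem_shadow hA hx hj
        have := hD x (hA hx)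
        exact lt_of_le_of_lt (by exact_mod_cast (by omega : x j + 1 ≤ D + 1)) hDc'
    have h3 : up M i ∉ A.image (fun x => up x j) := by
      rw [Finset.mem_image]
      rintro ⟨x, hx, hxe⟩
      have h4 := congrFun hxe i
      simp only [hui, huj] at h4
      have h5 : x i ≤ M i := hmax x hx
      omega
    have h4 := Finset.card_le_card h1
    have h5 := Finset.card_le_card h2
    rw [Finset.card_insert_of_notMem h3, himj] at h5
    have h6 := Finset.card_insert_le (up m j) (C.image (fun x => up x i))
    rw [himi] at h6
    omega
  · by_cases hAF : ∃ q ∈ Fib c {i, j} b d, q ∉ A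
    · obtain ⟨q, hqF, hqA⟩ := hAF
      have h1 : shadow c {i, j} C ⊆ C.image (fun x => up x j) := by
        intro y hy
        have hyF := shadow_sub hC.1 hy
        obtain ⟨⟨x, hx, k, hk, rfl⟩, hyc⟩ := mem_shadow.1 hy
        rw [Finset.mem_image]
        simp only [Finset.mem_insert, Finset.mem_singleton] at hk
        rcases hk with rfl | rfl
        · have h3 := hD x (hC.1 hx)
          have h4 : x j ≠ 0 := by
            intro h0
            have h5 := hyc k
            rw [hui] at h5
            exact hDc (by rwa [← h3, h0, add_zero])
          have h6 : up x k j = x j := up_ne _ (Ne.symm hne)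
          have hw : dn (up x k) j ∈ Fib c {k, j} b d := Fib_dn hyF hj (by omega)
          refine ⟨_, hC.2 x hx _ hw ?_, up_dn _ (by omega)⟩
          refine ⟨k, fun r hr => ?_, ?_⟩
          · rw [dn_ne _ (by omega), up_ne _ (by omega)]
          · rw [dn_ne _ hne, hui]; omega
        · exact ⟨x, hx, rfl⟩
      have h2 : A.card ≤ (shadow c {i, j} A).card := by
        apply Finset.card_le_card_of_injOn (fun x => if x i < q i then up x i else up x j)
        · intro x hx
          have hx : x ∈ A := hx
          have hxq : x i ≠ q i := fun h => hqA (by rw [← hext _ x (hA hx) q hqF h]; exact hx)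
          have hq1 := hD q hqF
          have hx1 := hD x (hA hx)
          have hqc := (mem_Fib.1 hqF).2.1
          show (if x i < q i then up x i else up x j) ∈ shadow c {i, j} A
          split_ifs with h
          · apply up_mem_shadow hA hx hi
            exact lt_of_le_of_lt (by exact_mod_cast (by omega : x i + 1 ≤ q i)) (hqc i)
          · apply up_mem_shadow hA hx hj
            exact lt_of_le_of_lt (by exact_mod_cast (by omega : x j + 1 ≤ q j)) (hqc j)
        · intro x hx y hy hxy
          have hx : x ∈ A := hx
          have hy : y ∈ A := hy
          have hxq : x i ≠ q i := fun h => hqA (by rw [← hext _ x (hA hx) q hqF h]; exact hx)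
          have hyq : y i ≠ q i := fun h => hqA (by rw [← hext _ y (hA hy) q hqF h]; exact hy)
          simp only at hxy
          split_ifs at hxy with h h' h'
          · exact up_inj hxy
          · have := congrFun hxy i
            rw [hui, huj] at this; omega
          · have := congrFun hxy i
            rw [hui, huj] at this; omega
          · exact up_inj hxy
      have h3 := Finset.card_le_card h1
      rw [himj] at h3
      omega
    · push Not at hAF
      exact Finset.card_le_card (shadow_mono (fun x hx => hAF x (hC.1 hx)))

/-- the inductive claim -/
def Claim {n : ℕ} (c : Fin n → ℕ∞) (s : Finset (Fin n)) : Prop :=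
  ∀ (b : Fin n → ℕ) (d : ℕ) (A C : Finset (Fin n → ℕ)), A ⊆ Fib c s b d →
    Seg (Fib c s b d) C → C.card ≤ A.card → (shadow c s C).card ≤ (shadow c s A).card

theorem compress {n : ℕ} {c : Fin n → ℕ∞} {s : Finset (Fin n)} {A : Finset (Fin n → ℕ)}
    {b : Fin n → ℕ} {d : ℕ} (hA : A ⊆ Fib c s b d) {i : Fin n} (hi : i ∈ s)
    (ih : Claim c (s.erase i)) :
    ∃ C ⊆ Fib c s b d, (∀ k, (C.filter (fun x => x i = k)).card = (A.filter (fun x => x i = k)).card)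
      ∧ (shadow c s C).card ≤ (shadow c s A).card ∧
      (∀ x ∈ C, ∀ y ∈ Fib c s b d, x i = y i → LL x y → y ∈ C) := by
  classical
  have hAs : ∀ k, A.filter (fun x => x i = k) ⊆ Fib c (s.erase i) (Function.update b i k) d := by
    intro k; rw [Fib_slice hi]; exact Finset.filter_subset_filter _ hA
  choose f hf hfc using fun k => Seg_exists (Fib c (s.erase i) (Function.update b i k) d)
    (A.filter (fun x => x i = k)).card (Finset.card_le_card (hAs k))
  have hfk : ∀ k, ∀ x ∈ f k, x ∈ Fib c s b d ∧ x i = k := by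
    intro k x hx
    have := (hf k).1 hx
    rw [Fib_slice hi] at this
    simpa using this
  let C := (Fib c s b d).filter (fun x => x ∈ f (x i))
  have hCf : ∀ k, C.filter (fun x => x i = k) = f k := by
    intro k
    ext x
    simp only [C, Finset.mem_filter]
    constructor
    · rintro ⟨⟨_, h⟩, rfl⟩; exact h
    · intro h
      obtain ⟨h1, h2⟩ := hfk k x h
      exact ⟨⟨h1, by rw [h2]; exact h⟩, h2⟩
  have hCF : C ⊆ Fib c s b d := Finset.filter_subset _ _
  refine ⟨C, hCF, fun k => by rw [hCf, hfc], ?_, ?_⟩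
  · -- slicewise comparison
    have hslice : ∀ k, ((shadow c s C).filter (fun x => x i = k)).card ≤
        ((shadow c s A).filter (fun x => x i = k)).card := by
      intro k
      -- part one
      have hA1 : shadow c (s.erase i) (A.filter (fun x => x i = k)) ⊆
          (shadow c s A).filter (fun x => x i = k) := by
        intro y hy
        obtain ⟨⟨x, hx, j, hj, rfl⟩, hc⟩ := mem_shadow.1 hy
        rw [Finset.mem_filter] at hx ⊢
        rw [Finset.mem_erase] at hj
        exact ⟨mem_shadow.2 ⟨⟨x, hx.1, j, hj.2, rfl⟩, hc⟩, by
          rw [up_ne _ (Ne.symm hj.1)]; exact hx.2⟩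
      have h1 : (shadow c (s.erase i) (f k)).card ≤
          ((shadow c s A).filter (fun x => x i = k)).card :=
        (ih _ _ _ _ (hAs k) (hf k) (hfc k).le).trans (Finset.card_le_card hA1)
      by_cases hk : 0 < k ∧ (k : ℕ∞) < c i
      · obtain ⟨k', rfl⟩ : ∃ k', k = k' + 1 := ⟨k - 1, by omega⟩
        have hA2 : (A.filter (fun x => x i = k')).image (fun x => up x i) ⊆
            (shadow c s A).filter (fun x => x i = k' + 1) := by
          intro y hy
          rw [Finset.mem_image] at hy
          obtain ⟨x, hx, rfl⟩ := hy
          rw [Finset.mem_filter] at hx ⊢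
          refine ⟨up_mem_shadow hA hx.1 hi (by rw [hx.2]; exact hk.2), ?_⟩
          rw [up_same, hx.2]
        have h2 : ((f k').image (fun x => up x i)).card ≤
            ((shadow c s A).filter (fun x => x i = k' + 1)).card := by
          rw [Finset.card_image_of_injective _ (fun x y h => up_inj h), hfc,
            ← Finset.card_image_of_injective _ (fun x y h => up_inj (i := i) h)]
          exact Finset.card_le_card hA2
        have hsub : (shadow c s C).filter (fun x => x i = k' + 1) ⊆
            shadow c (s.erase i) (f (k' + 1)) ∪ (f k').image (fun x => up x i) := by
          intro y hy
          rw [Finset.mem_filter] at hy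
          obtain ⟨⟨⟨x, hx, j, hj, rfl⟩, hc⟩, hyk⟩ := And.imp_left mem_shadow.1 hy
          rw [Finset.mem_union]
          by_cases hji : j = i
          · subst hji
            right
            rw [Finset.mem_image]
            rw [up_same] at hyk
            exact ⟨x, by rw [← hCf]; exact Finset.mem_filter.2 ⟨hx, by omega⟩, rfl⟩
          · left
            rw [up_ne _ (Ne.symm hji)] at hyk
            refine mem_shadow.2 ⟨⟨x, ?_, j, Finset.mem_erase.2 ⟨hji, hj⟩, rfl⟩, hc⟩
            rw [← hCf]; exact Finset.mem_filter.2 ⟨hx, hyk⟩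
        have hs1 := shadow_Seg (hf (k' + 1))
        have hs2 : Seg (Fib c (s.erase i) (Function.update b i (k' + 1)) (d + 1))
            ((f k').image (fun x => up x i)) := by
          rw [Fib_slice hi]
          constructor
          · intro y hy
            obtain ⟨x, hx, rfl⟩ := Finset.mem_image.1 hy
            obtain ⟨h3, h4⟩ := hfk _ x hx
            exact Finset.mem_filter.2 ⟨Fib_up h3 hi (by rw [h4]; exact hk.2), by
              rw [up_same, h4]⟩
          · intro y hy z hz hyz
            obtain ⟨x, hx, rfl⟩ := Finset.mem_image.1 hy
            obtain ⟨h3, h4⟩ := hfk _ x hx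
            rw [Finset.mem_filter] at hz
            have hz0 : 0 < z i := by omega
            refine Finset.mem_image.2 ⟨dn z i, ?_, up_dn z hz0⟩
            apply (hf k').2 x hx
            · rw [Fib_slice hi, Finset.mem_filter]
              exact ⟨Fib_dn hz.1 hi hz0, by rw [dn_same]; omega⟩
            · obtain ⟨p, hp, hpz⟩ := hyz
              have hpi : p ≠ i := by
                rintro rfl
                rw [up_same] at hpz; omega
              refine ⟨p, fun r hr => ?_, ?_⟩
              · have h5 := hp r hr
                by_cases hri : r = i
                · subst hri; rw [dn_same, ← h5, up_same]; omega
                · rw [dn_ne _ hri, ← h5, up_ne _ hri]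
              · rw [up_ne _ hpi] at hpz
                rw [dn_ne _ hpi]; exact hpz
        have h3 := Finset.card_le_card hsub
        rcases Seg_nested hs1 hs2 with h4 | h4
        · rw [Finset.union_eq_right.2 h4] at h3; omega
        · rw [Finset.union_eq_left.2 h4] at h3; omega
      · refine le_trans (Finset.card_le_card ?_) h1
        intro y hy
        rw [Finset.mem_filter] at hy
        obtain ⟨⟨⟨x, hx, j, hj, rfl⟩, hc⟩, hyk⟩ := And.imp_left mem_shadow.1 hy
        by_cases hji : j = i
        · subst hji
          exfalso
          apply hk
          rw [← hyk]
          exact ⟨by rw [up_same]; omega, hc j⟩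
        · rw [up_ne _ (Ne.symm hji)] at hyk
          refine mem_shadow.2 ⟨⟨x, ?_, j, Finset.mem_erase.2 ⟨hji, hj⟩, rfl⟩, hc⟩
          rw [← hCf]; exact Finset.mem_filter.2 ⟨hx, hyk⟩
    let T := (shadow c s C ∪ shadow c s A).image (fun x => x i)
    rw [Finset.card_eq_sum_card_fiberwise (f := fun x => x i) (t := T),
      Finset.card_eq_sum_card_fiberwise (f := fun x => x i) (t := T)]
    · exact Finset.sum_le_sum (fun k _ => hslice k)
    · intro x hx
      exact Finset.mem_coe.2 (Finset.mem_image_of_mem _ (Finset.mem_union_right _ hx))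
    · intro x hx
      exact Finset.mem_coe.2 (Finset.mem_image_of_mem _ (Finset.mem_union_left _ hx))
  · intro x hx y hy hxy hlt
    have hx' : x ∈ f (x i) := (Finset.mem_filter.1 hx).2
    refine Finset.mem_filter.2 ⟨hy, ?_⟩
    rw [← hxy]
    apply (hf (x i)).2 x hx' y _ hlt
    rw [Fib_slice hi, Finset.mem_filter]
    exact ⟨hy, hxy.symm⟩

theorem CL_large {n : ℕ} {c : Fin n → ℕ∞} {s : Finset (Fin n)} (hs : 3 ≤ s.card)
    (ih : ∀ i ∈ s, Claim c (s.erase i)) : Claim c s := by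
  classical
  intro b d A C hA hC hcard
  let P := (Fib c s b d).powerset.filter
    (fun B => B.card = A.card ∧ (shadow c s B).card ≤ (shadow c s A).card)
  have hP : P.Nonempty := ⟨A, by simp [P, hA]⟩
  obtain ⟨B, hB, hmax⟩ := Finset.exists_max_image P
    (fun B => toColex (B.map (toLex : (Fin n → ℕ) ≃ Lex (Fin n → ℕ)).toEmbedding)) hP
  simp only [P, Finset.mem_filter, Finset.mem_powerset] at hB hmax
  obtain ⟨hBF, hBc, hBs⟩ := hB
  refine le_trans (CL_compressed hBF hs ?_ hC (by omega)) hBs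
  intro i hi
  obtain ⟨E, hEF, hEc, hEs, hEcomp⟩ := compress hBF hi (ih i hi)
  have hEcard : E.card = B.card := by
    let T := (E ∪ B).image (fun x => x i)
    rw [Finset.card_eq_sum_card_fiberwise (f := fun x => x i) (t := T),
      Finset.card_eq_sum_card_fiberwise (s := B) (f := fun x => x i) (t := T)]
    · exact Finset.sum_congr rfl (fun k _ => hEc k)
    · intro x hx
      exact Finset.mem_coe.2 (Finset.mem_image_of_mem _ (Finset.mem_union_right _ hx))
    · intro x hx
      exact Finset.mem_coe.2 (Finset.mem_image_of_mem _ (Finset.mem_union_left _ hx))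
  have hle := hmax E ⟨hEF, by omega, by omega⟩
  have hEB : E = B := by
    by_contra hne
    refine absurd hle (not_le.2 ?_)
    rw [Finset.Colex.toColex_lt_toColex]
    constructor
    · intro h
      exact hne (Finset.map_injective _ h).symm
    · intro a ha haE
      obtain ⟨x, hx, rfl⟩ := Finset.mem_map.1 ha
      have hxE : x ∉ E := fun h => haE (Finset.mem_map.2 ⟨x, h, rfl⟩)
      have : ∃ y ∈ E.filter (fun y => y i = x i), y ∉ B.filter (fun y => y i = x i) := by
        by_contra! hcon
        have h1 := Finset.eq_of_subset_of_card_le hcon (hEc (x i)).ge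
        have : x ∈ B.filter (fun y => y i = x i) := by simp [hx]
        rw [← h1] at this
        exact hxE (Finset.mem_filter.1 this).1
      obtain ⟨y, hy, hyB⟩ := this
      rw [Finset.mem_filter] at hy hyB
      have hyB' : y ∉ B := fun h => hyB ⟨h, hy.2⟩
      refine ⟨toLex y, Finset.mem_map.2 ⟨y, hy.1, rfl⟩, ?_, ?_⟩
      · intro h
        obtain ⟨z, hz, hzy⟩ := Finset.mem_map.1 h
        have : z = y := toLex.injective hzy
        exact hyB' (this ▸ hz)
      · rcases LL_tri x y with h | h | h
        · exact le_of_lt h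
        · rw [h]; rfl
        · exact absurd (hEcomp y hy.1 x (hBF hx) hy.2 h) hxE
  rw [← hEB]; exact hEcomp

theorem CL {n : ℕ} {c : Fin n → ℕ∞} (hc : Monotone c) (k : ℕ) :
    ∀ s : Finset (Fin n), s.card = k → Claim c s := by
  induction k with
  | zero => intro s hs b d A C hA hC h; exact CL_small hA (by omega) hC h
  | succ k ih =>
    intro s hs
    by_cases h1 : s.card ≤ 1
    · intro b d A C hA hC h; exact CL_small hA h1 hC h
    by_cases h2 : s.card = 2
    · intro b d A C hA hC h
      obtain ⟨i, j, hij, rfl⟩ := Finset.card_eq_two.1 h2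
      rcases lt_or_gt_of_ne hij with h' | h'
      · exact CL_two hc h' hA hC h
      · rw [Finset.pair_comm] at *
        exact CL_two hc h' hA hC h
    · exact CL_large (by omega) (fun i hi => ih _ (by rw [Finset.card_erase_of_mem hi]; omega))

/-- the finitely supported exponent of a vector -/
noncomputable def fs {n : ℕ} (x : Fin n → ℕ) : Fin n →₀ ℕ := Finsupp.equivFunOnFinite.symm x

theorem fs_apply {n : ℕ} (x : Fin n → ℕ) (i : Fin n) : fs x i = x i := rfl

theorem fs_coe {n : ℕ} (m : Fin n →₀ ℕ) : fs (⇑m) = m := by ext i; rfl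

theorem fs_inj {n : ℕ} {x y : Fin n → ℕ} (h : fs x = fs y) : x = y :=
  Finsupp.equivFunOnFinite.symm.injective h

theorem fs_degree {n : ℕ} (x : Fin n → ℕ) : (fs x).degree = ∑ i, x i := by
  rw [Finsupp.degree_eq_sum]; rfl

def LM {n : ℕ} {K : Type*} [Field K] (L : Ideal (MvPolynomial (Fin n) K)) (d : ℕ)
    (x : Fin n → ℕ) : Prop :=
  ∃ f ∈ L, f.IsHomogeneous d ∧ coeff (fs x) f ≠ 0 ∧ ∀ y, coeff (fs y) f ≠ 0 → ¬ LL x y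

open Classical in
noncomputable def Std {n : ℕ} {K : Type*} [Field K] (L : Ideal (MvPolynomial (Fin n) K)) (d : ℕ) :
    Finset (Fin n → ℕ) :=
  ((Finset.univ : Finset (Fin n)).piAntidiag d).filter (fun x => ¬ LM L d x)

theorem mem_Std {n : ℕ} {K : Type*} [Field K] {L : Ideal (MvPolynomial (Fin n) K)} {d : ℕ}
    {x : Fin n → ℕ} : x ∈ Std L d ↔ ∑ i, x i = d ∧ ¬ LM L d x := by
  simp [Std]

open Classical in
noncomputable def mW {n : ℕ} (K : Type*) [Field K] (d : ℕ) (x : Fin n → ℕ) :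
    homogeneousSubmodule (Fin n) K d :=
  ⟨if ∑ i, x i = d then monomial (fs x) 1 else 0, by
    split_ifs with h
    · rw [mem_homogeneousSubmodule]
      exact isHomogeneous_monomial _ (by rw [fs_degree, h])
    · exact Submodule.zero_mem _⟩

theorem mW_coe {n : ℕ} {K : Type*} [Field K] {d : ℕ} {x : Fin n → ℕ} (h : ∑ i, x i = d) :
    (mW K d x : MvPolynomial (Fin n) K) = monomial (fs x) 1 := by
  simp [mW, h]

theorem coeff_zero_of_deg {n : ℕ} {K : Type*} [Field K] {d : ℕ} {f : MvPolynomial (Fin n) K}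
    (hf : f.IsHomogeneous d) {x : Fin n → ℕ} (hx : coeff (fs x) f ≠ 0) : ∑ i, x i = d := by
  have := hf hx
  have h2 : (Finsupp.weight (1 : Fin n → ℕ)) (fs x) = (fs x).degree := by
    rw [Finsupp.degree_eq_weight_one]; rfl
  rwa [h2, fs_degree] at this

theorem coeff_comb {n : ℕ} {K : Type*} [Field K] {d : ℕ} (T : Finset (Fin n → ℕ))
    (hT : ∀ x ∈ T, ∑ i, x i = d) (g : (Fin n → ℕ) → K) (y : Fin n → ℕ) [Decidable (y ∈ T)] :
    coeff (fs y) ((∑ x ∈ T, g x • mW K d x : homogeneousSubmodule (Fin n) K d) :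
      MvPolynomial (Fin n) K) = if y ∈ T then g y else 0 := by
  classical
  rw [Submodule.coe_sum, coeff_sum]
  have : ∀ x ∈ T, coeff (fs y) ((g x • mW K d x : homogeneousSubmodule (Fin n) K d) :
      MvPolynomial (Fin n) K) = if x = y then g y else 0 := by
    intro x hx
    rw [Submodule.coe_smul, mW_coe (hT x hx), coeff_smul, coeff_monomial]
    by_cases h : x = y
    · subst h; simp
    · rw [if_neg (fun h' => h (fs_inj h')), if_neg h]; simp
  rw [Finset.sum_congr rfl this, Finset.sum_ite_eq']
  congr

theorem expand {n : ℕ} {K : Type*} [Field K] {d : ℕ} (w : homogeneousSubmodule (Fin n) K d) :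
    w = ∑ x ∈ (Finset.univ : Finset (Fin n)).piAntidiag d,
      coeff (fs x) (w : MvPolynomial (Fin n) K) • mW K d x := by
  classical
  apply Subtype.ext
  ext m
  rw [← fs_coe m, coeff_comb _ (by intro x hx; simpa using hx)
    (fun x => coeff (fs x) (w : MvPolynomial (Fin n) K))]
  split_ifs with h
  · rfl
  · by_contra h'
    exact h (by simpa using coeff_zero_of_deg w.2 h')

theorem hilb_eq {n : ℕ} {K : Type*} [Field K] (L : Ideal (MvPolynomial (Fin n) K)) (d : ℕ) :
    hilbertFn K L d = (Std L d).card := by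
  classical
  unfold hilbertFn
  set W := homogeneousSubmodule (Fin n) K d
  set U : Submodule K W := Submodule.comap W.subtype (Submodule.restrictScalars K L) with hU
  have hUmem : ∀ w : W, w ∈ U ↔ (w : MvPolynomial (Fin n) K) ∈ L := fun w => Iff.rfl
  let v : Std L d → W ⧸ U := fun x => U.mkQ (mW K d x.1)
  have hStd : ∀ x ∈ Std L d, ∑ i, x i = d := fun x hx => (mem_Std.1 hx).1
  have hli : LinearIndependent K v := by
    rw [Fintype.linearIndependent_iff]
    intro g hg
    by_contra! hcon
    let g' : (Fin n → ℕ) → K := fun x => if h : x ∈ Std L d then g ⟨x, h⟩ else 0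
    let w : W := ∑ x ∈ Std L d, g' x • mW K d x
    have hw : U.mkQ w = 0 := by
      rw [← hg, map_sum, ← Finset.sum_coe_sort]
      apply Finset.sum_congr rfl
      intro x _
      simp only [map_smul, v, g']
      rw [dif_pos x.2]
    have hwU : w ∈ U := by simpa using hw
    obtain ⟨i, hi⟩ := hcon
    have hne : ((Std L d).filter (fun x => g' x ≠ 0)).Nonempty :=
      ⟨i.1, Finset.mem_filter.2 ⟨i.2, by simpa [g', i.2] using hi⟩⟩
    obtain ⟨m, hm, hmax⟩ := Finset.exists_max_image _ (fun x => toLex x) hne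
    rw [Finset.mem_filter] at hm
    apply (mem_Std.1 hm.1).2
    refine ⟨w, (hUmem w).1 hwU, w.2, ?_, ?_⟩
    · rw [coeff_comb _ hStd, if_pos hm.1]; exact hm.2
    · intro y hy
      rw [coeff_comb _ hStd] at hy
      have hyS : y ∈ Std L d := by by_contra h; simp [h] at hy
      rw [if_pos hyS] at hy
      exact not_lt.2 (hmax y (Finset.mem_filter.2 ⟨hyS, hy⟩))
  have hmon : ∀ z : Lex (Fin n → ℕ), ∑ i, ofLex z i = d →
      U.mkQ (mW K d (ofLex z)) ∈ Submodule.span K (Set.range v) := by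
    intro z
    induction z using WellFoundedLT.induction with
    | _ z ih =>
    intro hz
    by_cases hS : ofLex z ∈ Std L d
    · exact Submodule.subset_span ⟨⟨ofLex z, hS⟩, rfl⟩
    have hLM : LM L d (ofLex z) := by
      by_contra h; exact hS (mem_Std.2 ⟨hz, h⟩)
    obtain ⟨f, hfL, hfd, hf0, hfl⟩ := hLM
    let w : W := ⟨f, hfd⟩
    have hw : U.mkQ w = 0 := by
      rw [Submodule.mkQ_apply, Submodule.Quotient.mk_eq_zero]; exact hfL
    have hzm : ofLex z ∈ (Finset.univ : Finset (Fin n)).piAntidiag d :=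
      Finset.mem_piAntidiag.2 ⟨hz, by simp⟩
    rw [expand w, ← Finset.add_sum_erase _ _ hzm, map_add, map_smul] at hw
    have h1 : coeff (fs (ofLex z)) f • U.mkQ (mW K d (ofLex z)) ∈
        Submodule.span K (Set.range v) := by
      rw [eq_neg_of_add_eq_zero_left hw]
      apply Submodule.neg_mem
      rw [map_sum]
      apply Submodule.sum_mem
      intro y hy
      rw [map_smul]
      by_cases hy0 : coeff (fs y) f = 0
      · have : coeff (fs y) (w : MvPolynomial (Fin n) K) = 0 := hy0
        rw [this, zero_smul]; exact Submodule.zero_mem _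
      · apply Submodule.smul_mem
        rw [Finset.mem_erase] at hy
        refine ih (toLex y) ?_ (by simpa using hy.2)
        rcases LL_tri y (ofLex z) with h | h | h
        · exact h
        · exact absurd h hy.1
        · exact absurd h (hfl y hy0)
    exact (Submodule.smul_mem_iff _ hf0).1 h1
  have hsp : ⊤ ≤ Submodule.span K (Set.range v) := by
    intro q _
    obtain ⟨w, rfl⟩ := U.mkQ_surjective q
    rw [expand w, map_sum]
    apply Submodule.sum_mem
    intro x hx
    rw [map_smul]
    exact Submodule.smul_mem _ _ (hmon (toLex x) (by simpa using hx))
  rw [Module.finrank_eq_card_basis (Module.Basis.mk hli hsp), Fintype.card_coe]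

theorem fs_up {n : ℕ} (x : Fin n → ℕ) (i : Fin n) : fs (up x i) = fs x + Finsupp.single i 1 := by
  ext k
  simp only [fs_apply, up, Finsupp.add_apply, Finsupp.single_apply, eq_comm]

theorem LL_up {n : ℕ} {x y : Fin n → ℕ} (i : Fin n) (h : LL (up x i) (up y i)) : LL x y := by
  obtain ⟨p, hp, h⟩ := h
  refine ⟨p, fun q hq => ?_, ?_⟩
  · have := hp q hq
    simp only [up] at this; omega
  · simp only [up] at h; omega

theorem LM_up {n : ℕ} {K : Type*} [Field K] {L : Ideal (MvPolynomial (Fin n) K)} {d : ℕ}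
    {x : Fin n → ℕ} (h : LM L d x) (i : Fin n) : LM L (d+1) (up x i) := by
  obtain ⟨f, hfL, hfd, hf0, hfl⟩ := h
  refine ⟨f * X i, Ideal.mul_mem_right _ _ hfL, hfd.mul (isHomogeneous_X _ _), ?_, ?_⟩
  · rw [fs_up, coeff_mul_X]; exact hf0
  · intro y hy hlt
    rw [coeff_mul_X'] at hy
    split_ifs at hy with hi
    · have hi0 : 0 < y i := by
        have := Finsupp.mem_support_iff.1 hi
        rw [fs_apply] at this; omega
      have hyy : y = up (dn y i) i := (up_dn y hi0).symm
      have : fs y - Finsupp.single i 1 = fs (dn y i) := by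
        conv_lhs => rw [hyy, fs_up]
        simp
      rw [this] at hy
      rw [hyy] at hlt
      exact hfl _ hy (LL_up i hlt)
    · exact hy rfl

/-- ideal of polynomials supported on an up-closed set of exponents -/
def monIdeal {n : ℕ} (K : Type*) [Field K] (U : Set (Fin n → ℕ))
    (hU : ∀ x ∈ U, ∀ y, (∀ i, x i ≤ y i) → y ∈ U) : Ideal (MvPolynomial (Fin n) K) where
  carrier := {f | ∀ x, coeff (fs x) f ≠ 0 → x ∈ U}
  zero_mem' := by intro x hx; simp at hx
  add_mem' := by
    intro f g hf hg x hx
    by_cases h : coeff (fs x) f = 0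
    · exact hg x (by rintro h'; exact hx (by rw [coeff_add, h, h', add_zero]))
    · exact hf x h
  smul_mem' := by
    classical
    intro g f hf x hx
    rw [smul_eq_mul, coeff_mul] at hx
    obtain ⟨p, hp, hp0⟩ := Finset.exists_ne_zero_of_sum_ne_zero hx
    rw [Finset.HasAntidiagonal.mem_antidiagonal] at hp
    have h1 : coeff p.2 f ≠ 0 := right_ne_zero_of_mul hp0
    rw [← fs_coe p.2] at h1
    refine hU _ (hf _ h1) x (fun i => ?_)
    rw [← fs_apply x, ← hp, Finsupp.add_apply]; omega

theorem mem_monIdeal {n : ℕ} {K : Type*} [Field K] {U : Set (Fin n → ℕ)}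
    {hU : ∀ x ∈ U, ∀ y, (∀ i, x i ≤ y i) → y ∈ U} {f : MvPolynomial (Fin n) K} :
    f ∈ monIdeal K U hU ↔ ∀ x, coeff (fs x) f ≠ 0 → x ∈ U := Iff.rfl

theorem monIdeal_graded {n : ℕ} {K : Type*} [Field K] {U : Set (Fin n → ℕ)}
    {hU : ∀ x ∈ U, ∀ y, (∀ i, x i ≤ y i) → y ∈ U} : IsGradedIdeal (monIdeal K U hU) := by
  intro f hf d x hx
  rw [coeff_homogeneousComponent] at hx
  split_ifs at hx with h
  · exact hf x hx
  · exact absurd rfl hx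

theorem monomial_mem_monIdeal {n : ℕ} {K : Type*} [Field K] {U : Set (Fin n → ℕ)}
    {hU : ∀ x ∈ U, ∀ y, (∀ i, x i ≤ y i) → y ∈ U} {x : Fin n → ℕ} (hx : x ∈ U) :
    (monomial (fs x) (1 : K)) ∈ monIdeal K U hU := by
  classical
  intro y hy
  rw [coeff_monomial] at hy
  split_ifs at hy with h
  · rw [← fs_inj h]; exact hx
  · exact absurd rfl hy

theorem LM_of_monomial {n : ℕ} {K : Type*} [Field K] {L : Ideal (MvPolynomial (Fin n) K)}
    {x : Fin n → ℕ} (hx : (monomial (fs x) (1 : K)) ∈ L) : LM L (∑ i, x i) x := by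
  classical
  refine ⟨_, hx, isHomogeneous_monomial _ (fs_degree x), by simp, ?_⟩
  intro y hy
  rw [coeff_monomial] at hy
  split_ifs at hy with h
  · rw [← fs_inj h]; exact LL_irrefl x
  · exact absurd rfl hy

theorem LM_monIdeal {n : ℕ} {K : Type*} [Field K] {U : Set (Fin n → ℕ)}
    {hU : ∀ x ∈ U, ∀ y, (∀ i, x i ≤ y i) → y ∈ U} {x : Fin n → ℕ} :
    LM (monIdeal K U hU) (∑ i, x i) x ↔ x ∈ U :=
  ⟨fun ⟨_, hf, _, h0, _⟩ => hf x h0, fun h => LM_of_monomial (monomial_mem_monIdeal h)⟩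

theorem up_closed {n : ℕ} {U : Set (Fin n → ℕ)} (h : ∀ x ∈ U, ∀ i, up x i ∈ U) :
    ∀ x ∈ U, ∀ y, (∀ i, x i ≤ y i) → y ∈ U := by
  have key : ∀ k, ∀ x ∈ U, ∀ y : Fin n → ℕ, (∀ i, x i ≤ y i) → ∑ i, y i = ∑ i, x i + k → y ∈ U := by
    intro k
    induction k with
    | zero =>
      intro x hx y hxy hs
      have : x = y := by
        funext i
        exact (Finset.sum_eq_sum_iff_of_le (fun i _ => hxy i)).1 (by omega) i (Finset.mem_univ i)
      rw [← this]; exact hx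
    | succ k ih =>
      intro x hx y hxy hs
      obtain ⟨i, hi⟩ : ∃ i, x i < y i := by
        by_contra! hcon
        have := Finset.sum_le_sum (fun i (_ : i ∈ Finset.univ) => hcon i)
        omega
      refine ih (up x i) (h x hx i) y (fun j => ?_) (by rw [sum_up]; omega)
      by_cases hj : j = i
      · subst hj; rw [up_same]; omega
      · rw [up_ne _ hj]; exact hxy j
  intro x hx y hxy
  have := Finset.sum_le_sum (fun i (_ : i ∈ Finset.univ) => hxy i)
  exact key (∑ i, y i - ∑ i, x i) x hx y hxy (by omega)

end CLaux

/-- **Lemma 23 of the paper.**  Let `I` be a graded ideal containing a homogeneous regular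
sequence `f₁,…,f_t` of degrees `a₁ ≤ ⋯ ≤ a_t`.  If for every `d ≥ 0` there is a graded ideal
`L_d` whose degree `d` and `d+1` components contain those of `P = (x₁^{a₁},…,x_t^{a_t})`,
with `H(S/L_d, d) = H(S/I, d)` and `H(S/L_d, d+1) ≥ H(S/I, d+1)`, then `I` has the same
Hilbert function as a graded ideal containing `x₁^{a₁},…,x_t^{a_t}`. -/
theorem hilbert_function_of_ideal_with_degreewise_lpp_approximations
    {n t : ℕ} (htn : t ≤ n) (K : Type*) [Field K]
    (I : Ideal (MvPolynomial (Fin n) K)) (hIgr : IsGradedIdeal I)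
    (a : Fin t → ℕ) (ha : Monotone a)
    (f : Fin t → MvPolynomial (Fin n) K)
    (hfI : ∀ i, f i ∈ I)
    (hfhom : ∀ i, (f i).IsHomogeneous (a i))
    (hfreg : RingTheory.Sequence.IsRegular (MvPolynomial (Fin n) K) (List.ofFn f))
    (hL : ∀ d : ℕ, ∃ L : Ideal (MvPolynomial (Fin n) K), IsGradedIdeal L ∧
      (∀ g ∈ Ideal.span (Set.range fun i : Fin t =>
          (X (Fin.castLE htn i) : MvPolynomial (Fin n) K) ^ a i),
        g.IsHomogeneous d → g ∈ L) ∧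
      (∀ g ∈ Ideal.span (Set.range fun i : Fin t =>
          (X (Fin.castLE htn i) : MvPolynomial (Fin n) K) ^ a i),
        g.IsHomogeneous (d + 1) → g ∈ L) ∧
      hilbertFn K L d = hilbertFn K I d ∧
      hilbertFn K I (d + 1) ≤ hilbertFn K L (d + 1)) :
    ∃ J : Ideal (MvPolynomial (Fin n) K), IsGradedIdeal J ∧
      (∀ i : Fin t, (X (Fin.castLE htn i) : MvPolynomial (Fin n) K) ^ a i ∈ J) ∧
      ∀ d : ℕ, hilbertFn K J d = hilbertFn K I d := by
  classical
  let c : Fin n → ℕ∞ := fun i => if h : i.1 < t then (a ⟨i.1, h⟩ : ℕ∞) else ⊤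
  have hc : Monotone c := by
    intro i j hij
    simp only [c]
    by_cases hj : j.1 < t
    · have hi : i.1 < t := lt_of_le_of_lt hij hj
      rw [dif_pos hi, dif_pos hj]
      exact_mod_cast ha (show (⟨i.1, hi⟩ : Fin t) ≤ ⟨j.1, hj⟩ from hij)
    · rw [dif_neg hj]; exact le_top
  let B : ℕ → Finset (Fin n → ℕ) := fun d => CLaux.Fib c Finset.univ 0 d
  have hB : ∀ d x, x ∈ B d ↔ ∑ i, x i = d ∧ ∀ i, (x i : ℕ∞) < c i := by
    intro d x; simp [B, CLaux.mem_Fib]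
  -- standard monomials lie in the box
  have hbox : ∀ (L : Ideal (MvPolynomial (Fin n) K)) (d : ℕ),
      (∀ g ∈ Ideal.span (Set.range fun i : Fin t =>
          (X (Fin.castLE htn i) : MvPolynomial (Fin n) K) ^ a i),
        g.IsHomogeneous d → g ∈ L) → CLaux.Std L d ⊆ B d := by
    intro L d hLd x hx
    rw [CLaux.mem_Std] at hx
    rw [hB]
    refine ⟨hx.1, fun i => ?_⟩
    by_contra hcon
    rw [not_lt] at hcon
    have hit : i.1 < t := by
      by_contra h
      simp [c, h] at hcon
    simp only [c, dif_pos hit] at hcon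
    have hcon' : a ⟨i.1, hit⟩ ≤ x i := by exact_mod_cast hcon
    apply hx.2
    rw [← hx.1]
    apply CLaux.LM_of_monomial
    apply hLd
    · have hdvd : (X (Fin.castLE htn ⟨i.1, hit⟩) : MvPolynomial (Fin n) K) ^ a ⟨i.1, hit⟩ ∣
          monomial (CLaux.fs x) (1 : K) := by
        rw [X_pow_eq_monomial, monomial_dvd_monomial]
        refine ⟨Or.inr ?_, one_dvd _⟩
        rw [Finsupp.single_le_iff]
        exact hcon'
      exact Ideal.mem_of_dvd _ hdvd (Ideal.subset_span ⟨⟨i.1, hit⟩, rfl⟩)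
    · exact isHomogeneous_monomial _ (by rw [CLaux.fs_degree, hx.1])
  have hle : ∀ d, hilbertFn K I d ≤ (B d).card := by
    intro d
    obtain ⟨L, _, h1, _, h3, _⟩ := hL d
    rw [← h3, CLaux.hilb_eq]
    exact Finset.card_le_card (hbox L d h1)
  choose C hC hCc using fun d => CLaux.Seg_exists (B d) ((B d).card - hilbertFn K I d) (by omega)
  have hsh : ∀ d, CLaux.shadow c Finset.univ (C d) ⊆ C (d + 1) := by
    intro d
    obtain ⟨L, _, h1, h2, h3, h4⟩ := hL d
    rw [CLaux.hilb_eq L] at h3 h4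
    have hS1 := hbox L d h1
    have hS2 := hbox L (d + 1) h2
    have hA : B d \ CLaux.Std L d ⊆ CLaux.Fib c Finset.univ 0 d := Finset.sdiff_subset
    have hAc : (C d).card ≤ (B d \ CLaux.Std L d).card := by
      rw [Finset.card_sdiff_of_subset hS1, hCc, h3]
    have h5 := CLaux.CL hc _ Finset.univ rfl 0 d _ (C d) hA (hC d) hAc
    have h6 : CLaux.shadow c Finset.univ (B d \ CLaux.Std L d) ⊆
        B (d + 1) \ CLaux.Std L (d + 1) := by
      intro y hy
      have hyB := CLaux.shadow_sub hA hy
      obtain ⟨⟨x, hx, i, _, rfl⟩, _⟩ := CLaux.mem_shadow.1 hy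
      rw [Finset.mem_sdiff] at hx ⊢
      refine ⟨hyB, fun h => (CLaux.mem_Std.1 h).2 (CLaux.LM_up ?_ i)⟩
      by_contra hn
      exact hx.2 (CLaux.mem_Std.2 ⟨((hB d x).1 hx.1).1, hn⟩)
    have h7 := Finset.card_le_card h6
    rw [Finset.card_sdiff_of_subset hS2] at h7
    apply CLaux.Seg_sub (CLaux.shadow_Seg (hC d)) (hC (d + 1))
    rw [hCc]
    omega
  let U : Set (Fin n → ℕ) := {x | (∃ i, c i ≤ (x i : ℕ∞)) ∨ x ∈ C (∑ i, x i)}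
  have hU : ∀ x ∈ U, ∀ y, (∀ i, x i ≤ y i) → y ∈ U := by
    apply CLaux.up_closed
    intro x hx i
    by_cases hbx : ∃ j, c j ≤ (CLaux.up x i j : ℕ∞)
    · exact Or.inl hbx
    · rcases hx with ⟨j, hj⟩ | hx
      · exact absurd ⟨j, hj.trans (by exact_mod_cast CLaux.le_up x i j)⟩ hbx
      · right
        rw [CLaux.sum_up]
        push Not at hbx
        exact hsh _ (CLaux.mem_shadow.2 ⟨⟨x, hx, i, Finset.mem_univ i, rfl⟩, hbx⟩)
  refine ⟨CLaux.monIdeal K U hU, CLaux.monIdeal_graded, ?_, ?_⟩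
  · intro i
    rw [X_pow_eq_monomial, ← CLaux.fs_coe (Finsupp.single _ _)]
    apply CLaux.monomial_mem_monIdeal
    left
    refine ⟨Fin.castLE htn i, ?_⟩
    have : (Fin.castLE htn i).1 < t := i.2
    simp only [c, dif_pos this]
    simp
  · intro d
    rw [CLaux.hilb_eq]
    have : CLaux.Std (CLaux.monIdeal K U hU) d = B d \ C d := by
      ext x
      rw [CLaux.mem_Std, Finset.mem_sdiff, hB]
      constructor
      · rintro ⟨rfl, h⟩
        rw [CLaux.LM_monIdeal] at h
        refine ⟨⟨rfl, fun i => ?_⟩, fun h' => h (Or.inr h')⟩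
        by_contra h'
        exact h (Or.inl ⟨i, not_lt.1 h'⟩)
      · rintro ⟨⟨rfl, h1⟩, h2⟩
        refine ⟨rfl, ?_⟩
        rw [CLaux.LM_monIdeal]
        rintro (⟨i, hi⟩ | h)
        · exact absurd (h1 i) (not_lt.2 hi)
        · exact h2 h
    rw [this, Finset.card_sdiff_of_subset (hC d).1, hCc]
    have := hle d
    omega
end

section
/- Let S = K[x_1,...,x_n] over a field K, and let M be an ideal of S generated by products of linear forms (a totally reducible ideal) that contains a homogeneous regular sequence f_1,...,f_t with deg(f_i) = a_i and a_1 ≤ ... ≤ a_t. If I is any graded ideal of S containing M, then there exists a graded ideal J of S containing x_1^{a_1},...,x_t^{a_t} such that dim_K (S/J)_d = dim_K (S/I)_d for all d ≥ 0. -/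
set_option synthInstance.maxHeartbeats 1000000
set_option maxHeartbeats 1000000

open MvPolynomial

/-- An ideal of `S = K[x₁,…,xₙ]` is totally reducible if it is generated by
products of linear forms. -/
def TotallyReducible {n : ℕ} {K : Type*} [Field K] (I : Ideal (MvPolynomial (Fin n) K)) : Prop :=
  ∃ G : Set (MvPolynomial (Fin n) K), I = Ideal.span G ∧
    ∀ g ∈ G, ∃ (k : ℕ) (ℓ : Fin k → MvPolynomial (Fin n) K),
      (∀ i, (ℓ i).IsHomogeneous 1) ∧ g = ∏ i, ℓ i


namespace EGH

/-- lexicographic comparison -/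
def llt {n : ℕ} (u v : Fin n → ℕ) : Prop := ∃ i, (∀ j, j < i → u j = v j) ∧ u i < v i

lemma llt_iff {n : ℕ} (u v : Fin n → ℕ) : llt u v ↔ toLex u < toLex v := Iff.rfl

lemma llt_trans {n : ℕ} {u v w : Fin n → ℕ} (h : llt u v) (h' : llt v w) : llt u w := by
  rw [llt_iff] at *; exact h.trans h'

lemma llt_irrefl {n : ℕ} (u : Fin n → ℕ) : ¬ llt u u := by
  rw [llt_iff]; exact lt_irrefl _

lemma llt_tri {n : ℕ} (u v : Fin n → ℕ) : llt u v ∨ u = v ∨ llt v u := by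
  rw [llt_iff, llt_iff]
  rcases lt_trichotomy (toLex u) (toLex v) with h | h | h
  · exact Or.inl h
  · exact Or.inr (Or.inl (toLex.injective h))
  · exact Or.inr (Or.inr h)

lemma llt_asymm {n : ℕ} {u v : Fin n → ℕ} (h : llt u v) : ¬ llt v u :=
  fun h' => llt_irrefl _ (llt_trans h h')

/-- the degree `d` part of the box -/
noncomputable def B {n : ℕ} (a : Fin n → ℕ) (d : ℕ) : Finset (Fin n → ℕ) :=
  (Fintype.piFinset (fun i => Finset.range (a i))).filter (fun u => ∑ i, u i = d)

lemma mem_B {n : ℕ} {a : Fin n → ℕ} {d : ℕ} {u : Fin n → ℕ} :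
    u ∈ B a d ↔ (∀ i, u i < a i) ∧ ∑ i, u i = d := by
  simp [B]

open Classical in
/-- rank of an element -/
noncomputable def rk {n : ℕ} (a : Fin n → ℕ) (d : ℕ) (u : Fin n → ℕ) : ℕ :=
  ((B a d).filter (fun v => llt v u)).card

open Classical in
/-- initial segment of size k -/
noncomputable def Cs {n : ℕ} (a : Fin n → ℕ) (d k : ℕ) : Finset (Fin n → ℕ) :=
  (B a d).filter (fun u => rk a d u < k)

lemma mem_Cs {n : ℕ} {a : Fin n → ℕ} {d k : ℕ} {u : Fin n → ℕ} :
    u ∈ Cs a d k ↔ u ∈ B a d ∧ rk a d u < k := by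
  simp [Cs]

lemma rk_lt {n : ℕ} {a : Fin n → ℕ} {d : ℕ} {u v : Fin n → ℕ} (hu : u ∈ B a d)
    (h : llt u v) : rk a d u < rk a d v := by
  classical
  apply Finset.card_lt_card
  rw [Finset.ssubset_iff_of_subset]
  · exact ⟨u, by simp [hu, h], by simp [llt_irrefl]⟩
  · intro w hw
    simp only [Finset.mem_filter] at hw ⊢
    exact ⟨hw.1, llt_trans hw.2 h⟩

lemma rk_lt_card {n : ℕ} {a : Fin n → ℕ} {d : ℕ} {u : Fin n → ℕ} (hu : u ∈ B a d) :
    rk a d u < (B a d).card := by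
  classical
  apply Finset.card_lt_card
  rw [Finset.ssubset_iff_of_subset (Finset.filter_subset _ _)]
  exact ⟨u, hu, by simp [llt_irrefl]⟩

lemma rk_injOn {n : ℕ} (a : Fin n → ℕ) (d : ℕ) : Set.InjOn (rk a d) (B a d) := by
  intro u hu v hv h
  rcases llt_tri u v with h1 | h1 | h1
  · have := rk_lt hu h1; omega
  · exact h1
  · have := rk_lt hv h1; omega

lemma image_rk {n : ℕ} (a : Fin n → ℕ) (d : ℕ) :
    (B a d).image (rk a d) = Finset.range (B a d).card := by
  apply Finset.eq_of_subset_of_card_le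
  · intro x hx
    obtain ⟨u, hu, rfl⟩ := Finset.mem_image.1 hx
    exact Finset.mem_range.2 (rk_lt_card hu)
  · rw [Finset.card_range, Finset.card_image_of_injOn (rk_injOn a d)]

lemma Cs_sub {n : ℕ} (a : Fin n → ℕ) (d k : ℕ) : Cs a d k ⊆ B a d := fun _ h => (mem_Cs.1 h).1

lemma Cs_mono {n : ℕ} (a : Fin n → ℕ) (d : ℕ) {k k' : ℕ} (h : k ≤ k') : Cs a d k ⊆ Cs a d k' := by
  intro u hu; rw [mem_Cs] at *; exact ⟨hu.1, by omega⟩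

lemma Cs_init {n : ℕ} {a : Fin n → ℕ} {d k : ℕ} {u v : Fin n → ℕ} (hu : u ∈ Cs a d k)
    (hv : v ∈ B a d) (h : llt v u) : v ∈ Cs a d k := by
  rw [mem_Cs] at *; exact ⟨hv, (rk_lt hv h).trans hu.2⟩

lemma card_Cs {n : ℕ} (a : Fin n → ℕ) (d : ℕ) {k : ℕ} (hk : k ≤ (B a d).card) :
    (Cs a d k).card = k := by
  rw [← Finset.card_image_of_injOn ((rk_injOn a d).mono (Cs_sub a d k))]
  have : (Cs a d k).image (rk a d) = Finset.range k := by
    ext x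
    simp only [Finset.mem_image, Finset.mem_range, mem_Cs]
    constructor
    · rintro ⟨u, hu, rfl⟩; exact hu.2
    · intro hx
      have : x ∈ (B a d).image (rk a d) := by
        rw [image_rk, Finset.mem_range]; omega
      obtain ⟨u, hu, rfl⟩ := Finset.mem_image.1 this
      exact ⟨u, ⟨hu, hx⟩, rfl⟩
  rw [this, Finset.card_range]

lemma card_Cs_le {n : ℕ} (a : Fin n → ℕ) (d k : ℕ) : (Cs a d k).card ≤ k := by
  rcases le_total k (B a d).card with h | h
  · exact (card_Cs a d h).le
  · exact (Finset.card_le_card (Cs_sub a d k)).trans h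

lemma init_eq {n : ℕ} {a : Fin n → ℕ} {d : ℕ} {A : Finset (Fin n → ℕ)} (hA : A ⊆ B a d)
    (hi : ∀ u ∈ A, ∀ v ∈ B a d, llt v u → v ∈ A) : A = Cs a d A.card := by
  classical
  apply Finset.eq_of_subset_of_card_le
  · intro u hu
    rw [mem_Cs]
    refine ⟨hA hu, ?_⟩
    apply Finset.card_lt_card
    rw [Finset.ssubset_iff_of_subset]
    · exact ⟨u, hu, by simp [llt_irrefl]⟩
    · intro w hw
      simp only [Finset.mem_filter] at hw
      exact hi u hu w hw.1 hw.2
  · exact card_Cs_le _ _ _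

/-- unit vector -/
def e {n : ℕ} (i : Fin n) : Fin n → ℕ := Pi.single i 1

lemma e_self {n : ℕ} (i : Fin n) : e i i = 1 := by simp [e]
lemma e_ne {n : ℕ} {i j : Fin n} (h : j ≠ i) : e i j = 0 := by simp [e, h]
lemma sum_e {n : ℕ} (i : Fin n) : ∑ j, e i j = 1 := by simp [e]
lemma sum_add_e {n : ℕ} (u : Fin n → ℕ) (i : Fin n) : ∑ j, (u + e i) j = ∑ j, u j + 1 := by
  simp [Finset.sum_add_distrib, sum_e]

open Classical in
/-- lower shadow -/
noncomputable def sh {n : ℕ} (A : Finset (Fin n → ℕ)) : Finset (Fin n → ℕ) :=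
  A.biUnion (fun u => (Finset.univ.filter (fun i => 0 < u i)).image (fun i => u - e i))

lemma sub_add_e {n : ℕ} {u : Fin n → ℕ} {i : Fin n} (h : 0 < u i) : u - e i + e i = u := by
  funext j
  by_cases hj : j = i
  · subst hj; simp [e_self]; omega
  · simp [e_ne hj]

lemma mem_sh {n : ℕ} {A : Finset (Fin n → ℕ)} {v : Fin n → ℕ} :
    v ∈ sh A ↔ ∃ i, v + e i ∈ A := by
  classical
  simp only [sh, Finset.mem_biUnion, Finset.mem_image, Finset.mem_filter, Finset.mem_univ, true_and]
  constructor
  · rintro ⟨u, hu, i, hi, rfl⟩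
    exact ⟨i, by rwa [sub_add_e hi]⟩
  · rintro ⟨i, hi⟩
    exact ⟨_, hi, i, by simp [e_self], by simp⟩

lemma sh_mono {n : ℕ} {A A' : Finset (Fin n → ℕ)} (h : A ⊆ A') : sh A ⊆ sh A' := by
  intro v hv
  rw [mem_sh] at *
  obtain ⟨i, hi⟩ := hv
  exact ⟨i, h hi⟩

lemma sh_sub {n : ℕ} {a : Fin n → ℕ} {d : ℕ} {A : Finset (Fin n → ℕ)} (h : A ⊆ B a (d+1)) :
    sh A ⊆ B a d := by
  intro v hv
  rw [mem_sh] at hv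
  obtain ⟨i, hi⟩ := hv
  have := mem_B.1 (h hi)
  rw [sum_add_e] at this
  rw [mem_B]
  refine ⟨fun j => lt_of_le_of_lt ?_ (this.1 j), by omega⟩
  simp

lemma llt_add_e {n : ℕ} (u : Fin n → ℕ) (i : Fin n) : llt u (u + e i) :=
  ⟨i, fun j hj => by simp [e_ne hj.ne], by simp [e_self]⟩

/-- shadows of initial segments are initial -/
lemma sh_init {n : ℕ} {a : Fin n → ℕ} {d : ℕ} {A : Finset (Fin n → ℕ)} (hA : A ⊆ B a (d+1))
    (hi : ∀ u ∈ A, ∀ v ∈ B a (d+1), llt v u → v ∈ A) :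
    ∀ u ∈ sh A, ∀ v ∈ B a d, llt v u → v ∈ sh A := by
  intro w hw w' hw' hlt
  have hwB := mem_B.1 (sh_sub hA hw)
  rw [mem_sh] at hw
  obtain ⟨i, hiA⟩ := hw
  have hiB := mem_B.1 (hA hiA)
  have hw'B := mem_B.1 hw'
  obtain ⟨p, hp, hpl⟩ := hlt
  rw [mem_sh]
  by_cases hex : ∃ j, p < j ∧ w' j + 1 < a j
  · obtain ⟨j, hj, hja⟩ := hex
    refine ⟨j, hi _ hiA _ ?_ ?_⟩
    · rw [mem_B, sum_add_e]
      refine ⟨fun k => ?_, by omega⟩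
      by_cases hk : k = j
      · subst hk; simpa [e_self] using hja
      · simpa [e_ne hk] using hw'B.1 k
    · refine llt_trans ?_ (llt_add_e w i)
      exact ⟨p, fun k hk => by simp [e_ne (hk.trans hj).ne, hp k hk], by simp [e_ne hj.ne, hpl]⟩
  · push Not at hex
    have hB : w' + e p ∈ B a (d+1) := by
      rw [mem_B, sum_add_e]
      refine ⟨fun k => ?_, by omega⟩
      by_cases hk : k = p
      · subst hk; have := hwB.1 k; simp [e_self]; omega
      · simpa [e_ne hk] using hw'B.1 k
    refine ⟨p, ?_⟩
    rcases llt_tri (w' + e p) (w + e i) with h | h | h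
    · exact hi _ hiA _ hB h
    · rwa [h]
    · exfalso
      obtain ⟨q, hq, hql⟩ := h
      have hle : ∀ k, (w + e i) k ≤ (w' + e p) k := by
        intro k
        rcases lt_trichotomy k q with hk | hk | hk
        · exact (hq k hk).le
        · subst hk; exact hql.le
        · have hpq : p ≤ q := by
            by_contra hcon
            push Not at hcon
            have := hp q hcon
            simp [e_ne hcon.ne] at hql
            omega
          have h1 := hex k (lt_of_le_of_lt hpq hk)
          have h2 := hiB.1 k
          simp only [Pi.add_apply] at h2 ⊢
          omega
      have hs : ∑ k, (w + e i) k < ∑ k, (w' + e p) k :=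
        Finset.sum_lt_sum (fun k _ => hle k) ⟨q, Finset.mem_univ _, hql⟩
      rw [sum_add_e, sum_add_e] at hs
      omega

lemma Cs_sh_sub {n : ℕ} {a : Fin n → ℕ} {d k g : ℕ} (h : (sh (Cs a (d+1) k)).card ≤ g) :
    sh (Cs a (d+1) k) ⊆ Cs a d g := by
  have h1 := init_eq (sh_sub (Cs_sub a (d+1) k))
    (sh_init (Cs_sub a (d+1) k) (fun u hu v hv hl => Cs_init hu hv hl))
  rw [h1]
  exact Cs_mono a d h

end EGH


namespace EGH

/-- insert a coordinate -/
def ins {n : ℕ} (j : Fin (n+1)) (c : ℕ) (v : Fin n → ℕ) : Fin (n+1) → ℕ :=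
  Fin.insertNth (α := fun _ => ℕ) j c v

lemma ins_same {n : ℕ} (j : Fin (n+1)) (c : ℕ) (v : Fin n → ℕ) : ins j c v j = c := by simp [ins]
lemma ins_succ {n : ℕ} (j : Fin (n+1)) (c : ℕ) (v : Fin n → ℕ) (i : Fin n) :
    ins j c v (j.succAbove i) = v i := by simp [ins]

lemma ins_eta {n : ℕ} (j : Fin (n+1)) (u : Fin (n+1) → ℕ) : ins j (u j) (u ∘ j.succAbove) = u := by
  funext k
  rcases Fin.eq_self_or_eq_succAbove j k with h | ⟨i, h⟩
  · subst h; rw [ins_same]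
  · subst h; rw [ins_succ]; rfl

lemma ins_comp {n : ℕ} (j : Fin (n+1)) (c : ℕ) (v : Fin n → ℕ) :
    ins j c v ∘ j.succAbove = v := by
  funext i; exact ins_succ j c v i

lemma ins_inj {n : ℕ} {j : Fin (n+1)} {c : ℕ} {v w : Fin n → ℕ} (h : ins j c v = ins j c w) :
    v = w := by
  rw [← ins_comp j c v, h, ins_comp]

lemma ins_add_e {n : ℕ} (j : Fin (n+1)) (c : ℕ) (v : Fin n → ℕ) (i : Fin n) :
    ins j c v + e (j.succAbove i) = ins j c (v + e i) := by
  funext k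
  rcases Fin.eq_self_or_eq_succAbove j k with h | ⟨i', h⟩
  · subst h; simp [ins_same, e_ne (Fin.succAbove_ne k i).symm]
  · subst h
    by_cases h2 : i' = i
    · subst h2; simp [ins_succ, e_self]
    · have : j.succAbove i' ≠ j.succAbove i := fun h => h2 (Fin.succAbove_right_injective h)
      simp [ins_succ, e_ne h2, e_ne this]

lemma ins_add_e_self {n : ℕ} (j : Fin (n+1)) (c : ℕ) (v : Fin n → ℕ) :
    ins j c v + e j = ins j (c+1) v := by
  funext k
  rcases Fin.eq_self_or_eq_succAbove j k with h | ⟨i', h⟩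
  · subst h; simp [ins_same, e_self]
  · subst h; simp [ins_succ, e_ne (Fin.succAbove_ne j i')]

lemma llt_ins {n : ℕ} (j : Fin (n+1)) (c : ℕ) (u v : Fin n → ℕ) :
    llt (ins j c u) (ins j c v) ↔ llt u v := by
  constructor
  · rintro ⟨i, h1, h2⟩
    rcases Fin.eq_self_or_eq_succAbove j i with h | ⟨i', h⟩
    · subst h; simp [ins_same] at h2
    · subst h
      refine ⟨i', fun k hk => ?_, by simpa [ins_succ] using h2⟩
      have := h1 (j.succAbove k) ((Fin.strictMono_succAbove j) hk)
      simpa [ins_succ] using this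
  · rintro ⟨i, h1, h2⟩
    refine ⟨j.succAbove i, fun k hk => ?_, by simpa [ins_succ] using h2⟩
    rcases Fin.eq_self_or_eq_succAbove j k with h | ⟨i', h⟩
    · subst h; simp [ins_same]
    · subst h
      simp only [ins_succ]
      exact h1 i' ((Fin.strictMono_succAbove j).lt_iff_lt.1 hk)

lemma mem_B_ins {n : ℕ} {a : Fin (n+1) → ℕ} {d : ℕ} {j : Fin (n+1)} {c : ℕ} {v : Fin n → ℕ} :
    ins j c v ∈ B a d ↔ c < a j ∧ c ≤ d ∧ v ∈ B (a ∘ j.succAbove) (d - c) := by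
  rw [mem_B, mem_B, Fin.sum_univ_succAbove _ j, ins_same]
  simp only [ins_succ, Function.comp]
  constructor
  · rintro ⟨h1, h2⟩
    refine ⟨by simpa [ins_same] using h1 j, by omega, fun i => by simpa [ins_succ] using h1 (j.succAbove i), by omega⟩
  · rintro ⟨h1, h2, h3, h4⟩
    refine ⟨fun k => ?_, by omega⟩
    rcases Fin.eq_self_or_eq_succAbove j k with h | ⟨i', h⟩
    · subst h; simpa [ins_same]
    · subst h; simpa [ins_succ] using h3 i'

open Classical in
/-- slice -/
noncomputable def sl {n : ℕ} (j : Fin (n+1)) (c : ℕ) (X : Finset (Fin (n+1) → ℕ)) :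
    Finset (Fin n → ℕ) := (X.filter (fun u => u j = c)).image (fun u => u ∘ j.succAbove)

lemma mem_sl {n : ℕ} {j : Fin (n+1)} {c : ℕ} {X : Finset (Fin (n+1) → ℕ)} {v : Fin n → ℕ} :
    v ∈ sl j c X ↔ ins j c v ∈ X := by
  classical
  simp only [sl, Finset.mem_image, Finset.mem_filter]
  constructor
  · rintro ⟨u, ⟨h1, rfl⟩, rfl⟩
    rwa [ins_eta]
  · intro h
    exact ⟨_, ⟨h, ins_same _ _ _⟩, ins_comp _ _ _⟩

lemma card_sl {n : ℕ} (j : Fin (n+1)) (X : Finset (Fin (n+1) → ℕ)) (m : ℕ)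
    (h : ∀ u ∈ X, u j < m) : X.card = ∑ c ∈ Finset.range m, (sl j c X).card := by
  classical
  rw [Finset.card_eq_sum_card_fiberwise (f := fun u => u j) (t := Finset.range m)]
  · refine Finset.sum_congr rfl fun c _ => ?_
    rw [sl, Finset.card_image_of_injOn]
    intro u hu v hv huv
    simp only [Finset.coe_filter, Set.mem_setOf_eq] at hu hv
    rw [← ins_eta j u, ← ins_eta j v, hu.2, hv.2]
    exact congrArg _ huv
  · intro u hu
    simpa using h u hu

lemma sl_sh {n : ℕ} (j : Fin (n+1)) (c : ℕ) (X : Finset (Fin (n+1) → ℕ)) (v : Fin n → ℕ) :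
    v ∈ sl j c (sh X) ↔ v ∈ sh (sl j c X) ∨ v ∈ sl j (c+1) X := by
  rw [mem_sl, mem_sh, mem_sh, mem_sl]
  constructor
  · rintro ⟨k, hk⟩
    rcases Fin.eq_self_or_eq_succAbove j k with h | ⟨i', h⟩
    · subst h; rw [ins_add_e_self] at hk; exact Or.inr hk
    · subst h; rw [ins_add_e] at hk; exact Or.inl ⟨i', mem_sl.2 hk⟩
  · rintro (⟨i, hi⟩ | h)
    · exact ⟨j.succAbove i, by rw [ins_add_e]; exact mem_sl.1 hi⟩
    · exact ⟨j, by rwa [ins_add_e_self]⟩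

lemma sl_sub {n : ℕ} {a : Fin (n+1) → ℕ} {d : ℕ} {j : Fin (n+1)} {c : ℕ}
    {X : Finset (Fin (n+1) → ℕ)} (h : X ⊆ B a d) : sl j c X ⊆ B (a ∘ j.succAbove) (d - c) := by
  intro v hv
  rw [mem_sl] at hv
  exact (mem_B_ins.1 (h hv)).2.2

lemma sl_empty {n : ℕ} {a : Fin (n+1) → ℕ} {d : ℕ} {j : Fin (n+1)} {c : ℕ}
    {X : Finset (Fin (n+1) → ℕ)} (h : X ⊆ B a d) (hc : d < c) : sl j c X = ∅ := by
  rw [Finset.eq_empty_iff_forall_notMem]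
  intro v hv
  rw [mem_sl] at hv
  have := (mem_B_ins.1 (h hv)).2.1
  omega

open Classical in
/-- set with prescribed slices -/
noncomputable def TT {n : ℕ} (a : Fin (n+1) → ℕ) (d : ℕ) (j : Fin (n+1)) (h : ℕ → ℕ) :
    Finset (Fin (n+1) → ℕ) :=
  (B a d).filter (fun u => u ∘ j.succAbove ∈ Cs (a ∘ j.succAbove) (d - u j) (h (u j)))

lemma TT_sub {n : ℕ} (a : Fin (n+1) → ℕ) (d : ℕ) (j : Fin (n+1)) (h : ℕ → ℕ) :
    TT a d j h ⊆ B a d := Finset.filter_subset _ _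

lemma mem_sl_TT {n : ℕ} {a : Fin (n+1) → ℕ} {d : ℕ} {j : Fin (n+1)} {h : ℕ → ℕ} {c : ℕ}
    {v : Fin n → ℕ} : v ∈ sl j c (TT a d j h) ↔
      c < a j ∧ c ≤ d ∧ v ∈ Cs (a ∘ j.succAbove) (d - c) (h c) := by
  rw [mem_sl, TT, Finset.mem_filter, mem_B_ins, ins_comp, ins_same]
  constructor
  · rintro ⟨⟨h1, h2, h3⟩, h4⟩; exact ⟨h1, h2, h4⟩
  · rintro ⟨h1, h2, h4⟩; exact ⟨⟨h1, h2, Cs_sub _ _ _ h4⟩, h4⟩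

lemma sl_TT {n : ℕ} {a : Fin (n+1) → ℕ} {d : ℕ} {j : Fin (n+1)} {h : ℕ → ℕ} {c : ℕ}
    (hc : c < a j) (hd : c ≤ d) :
    sl j c (TT a d j h) = Cs (a ∘ j.succAbove) (d - c) (h c) := by
  ext v; rw [mem_sl_TT]; tauto

lemma card_TT {n : ℕ} (a : Fin (n+1) → ℕ) (d : ℕ) (j : Fin (n+1)) (h : ℕ → ℕ)
    (hh : ∀ c, c < a j → c ≤ d → h c ≤ (B (a ∘ j.succAbove) (d - c)).card) :
    (TT a d j h).card = ∑ c ∈ Finset.range (a j), if c ≤ d then h c else 0 := by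
  rw [card_sl j _ (a j) (fun u hu => (mem_B.1 (TT_sub _ _ _ _ hu)).1 j)]
  refine Finset.sum_congr rfl fun c hc => ?_
  rw [Finset.mem_range] at hc
  split_ifs with hd
  · rw [sl_TT hc hd, card_Cs _ _ (hh c hc hd)]
  · rw [sl_empty (TT_sub _ _ _ _) (by omega), Finset.card_empty]

lemma card_sh_TT {n : ℕ} (a : Fin (n+1) → ℕ) (d : ℕ) (j : Fin (n+1)) (h g : ℕ → ℕ)
    (h1 : ∀ c, c < a j → c ≤ d → (sh (Cs (a ∘ j.succAbove) (d - c + 1) (h c))).card ≤ g c)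
    (h2 : ∀ c, c + 1 < a j → c ≤ d → h (c+1) ≤ g c) :
    (sh (TT a (d+1) j h)).card ≤ ∑ c ∈ Finset.range (a j), if c ≤ d then g c else 0 := by
  have hsub := sh_sub (TT_sub a (d+1) j h)
  rw [card_sl j _ (a j) (fun u hu => (mem_B.1 (hsub hu)).1 j)]
  refine Finset.sum_le_sum fun c hc => ?_
  rw [Finset.mem_range] at hc
  split_ifs with hd
  · refine le_trans (Finset.card_le_card ?_) (card_Cs_le (a ∘ j.succAbove) (d - c) (g c))
    intro v hv
    rw [sl_sh] at hv
    rcases hv with hv | hv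
    · rw [sl_TT hc (by omega), show d + 1 - c = d - c + 1 by omega] at hv
      exact Cs_sh_sub (h1 c hc hd) hv
    · rw [mem_sl_TT, show d + 1 - (c+1) = d - c by omega] at hv
      exact Cs_mono _ _ (h2 c hv.1 hd) hv.2.2
  · rw [sl_empty hsub (by omega), Finset.card_empty]

/-- the Clements--Lindström property of a box -/
def CL {n : ℕ} (a : Fin n → ℕ) : Prop :=
  ∀ d, ∀ A ⊆ B a (d+1), (sh (Cs a (d+1) A.card)).card ≤ (sh A).card

/-- stable sets -/
def Stable {n : ℕ} (a : Fin n → ℕ) (d : ℕ) (A : Finset (Fin n → ℕ)) : Prop :=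
  ∀ x ∈ A, ∀ y ∈ B a d, llt y x → (∃ j, y j = x j) → y ∈ A

lemma compress {n : ℕ} (a : Fin (n+1) → ℕ) (j : Fin (n+1)) (hCL : CL (a ∘ j.succAbove)) (d : ℕ)
    (A : Finset (Fin (n+1) → ℕ)) (hA : A ⊆ B a (d+1)) :
    ∃ A' ⊆ B a (d+1), A'.card = A.card ∧ (sh A').card ≤ (sh A).card ∧
      (∀ c, c < a j → c ≤ d + 1 → sl j c A' = Cs (a ∘ j.succAbove) (d+1-c) (sl j c A).card) := by
  have hsub := sh_sub hA
  refine ⟨TT a (d+1) j (fun c => (sl j c A).card), TT_sub _ _ _ _, ?_, ?_, fun c hc hd => sl_TT hc hd⟩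
  · rw [card_TT]
    · rw [card_sl j A (a j) (fun u hu => (mem_B.1 (hA hu)).1 j)]
      refine Finset.sum_congr rfl fun c hc => ?_
      split_ifs with hd
      · rfl
      · rw [sl_empty hA (by omega), Finset.card_empty]
    · intro c _ _
      exact Finset.card_le_card (sl_sub hA)
  · refine le_trans (card_sh_TT a d j _ (fun c => (sl j c (sh A)).card) ?_ ?_) ?_
    · intro c hc hd
      refine le_trans (hCL (d - c) (sl j c A) ?_) (Finset.card_le_card ?_)
      · have := sl_sub (j := j) (c := c) hA
        rwa [show d + 1 - c = d - c + 1 by omega] at this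
      · intro v hv; rw [sl_sh]; exact Or.inl hv
    · intro c hc hd
      refine Finset.card_le_card ?_
      intro v hv; rw [sl_sh]; exact Or.inr hv
    · rw [card_sl j (sh A) (a j) (fun u hu => (mem_B.1 (hsub hu)).1 j)]
      refine Finset.sum_le_sum fun c hc => ?_
      split_ifs
      · exact le_rfl
      · exact Nat.zero_le _

lemma exists_stable {n : ℕ} (a : Fin (n+1) → ℕ) (hCL : ∀ j : Fin (n+1), CL (a ∘ j.succAbove))
    (d : ℕ) (A : Finset (Fin (n+1) → ℕ)) (hA : A ⊆ B a (d+1)) :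
    ∃ A' ⊆ B a (d+1), A'.card = A.card ∧ (sh A').card ≤ (sh A).card ∧ Stable a (d+1) A' := by
  classical
  let F := (B a (d+1)).powerset.filter (fun A' => A'.card = A.card ∧ (sh A').card ≤ (sh A).card)
  let φ : Finset (Fin (n+1) → ℕ) → Colex (Finset (Lex (Fin (n+1) → ℕ))) :=
    fun X => toColex (X.map (toLex : (Fin (n+1) → ℕ) ≃ _).toEmbedding)
  obtain ⟨A', hA', hmin⟩ := Finset.exists_min_image F φ ⟨A, by simp [F, hA]⟩
  simp only [F, Finset.mem_filter, Finset.mem_powerset] at hA' hmin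
  refine ⟨A', hA'.1, hA'.2.1, hA'.2.2, ?_⟩
  intro x hx y hy hyx ⟨j, hj⟩
  by_contra hyA
  obtain ⟨T, hT, hTc, hTs, hTsl⟩ := compress a j (hCL j) d A' hA'.1
  have hle := hmin T ⟨hT, hTc.trans hA'.2.1, hTs.trans hA'.2.2⟩
  have key : ∀ u ∈ T, u ∉ A' → ∃ v, v ∈ A' ∧ v ∉ T ∧ llt u v := by
    intro u hu huA
    have huB := hT hu
    rw [← ins_eta j u] at huB hu huA
    have hub := mem_B_ins.1 huB
    have hu' := mem_sl.2 hu
    have huA' := fun h => huA (mem_sl.1 h)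
    have hs := hTsl (u j) hub.1 hub.2.1
    have hc : (sl j (u j) T).card = (sl j (u j) A').card := by
      rw [hs, card_Cs]
      exact Finset.card_le_card (sl_sub hA'.1)
    have : ∃ v ∈ sl j (u j) A', v ∉ sl j (u j) T := by
      by_contra hcon
      push Not at hcon
      have := Finset.eq_of_subset_of_card_le hcon hc.le
      rw [this] at huA'
      exact huA' hu'
    obtain ⟨v, hv, hvT⟩ := this
    refine ⟨ins j (u j) v, mem_sl.1 hv, fun h => hvT (mem_sl.2 h), ?_⟩
    rw [← ins_eta j u, ins_same, llt_ins]
    rcases llt_tri (u ∘ j.succAbove) v with h | h | h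
    · exact h
    · rw [h] at hu'; exact absurd hu' hvT
    · exfalso
      apply hvT
      rw [hs] at hu' ⊢
      exact Cs_init hu' (sl_sub hA'.1 hv) h
  have hne : T ≠ A' := by
    intro h
    rw [h] at hTsl
    have hxB := hA'.1 hx
    rw [← ins_eta j x] at hxB hx hyx
    rw [← ins_eta j y, hj] at hyA hyx hy
    have hxb := mem_B_ins.1 hxB
    have hyb := mem_B_ins.1 hy
    have hs := hTsl (x j) hxb.1 hxb.2.1
    apply hyA
    rw [← mem_sl] at hx ⊢
    rw [hs] at hx ⊢
    exact Cs_init hx hyb.2.2 ((llt_ins _ _ _ _).1 hyx)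
  have hlt : φ T < φ A' := by
    rw [Finset.Colex.toColex_lt_toColex]
    refine ⟨fun h => hne (Finset.map_injective _ h), ?_⟩
    intro u hu hu'
    obtain ⟨u, hu2, rfl⟩ := Finset.mem_map.1 hu
    have : u ∉ A' := fun h => hu' (Finset.mem_map_of_mem _ h)
    obtain ⟨v, hv1, hv2, hv3⟩ := key u hu2 this
    refine ⟨toLex v, Finset.mem_map_of_mem _ hv1, ?_, le_of_lt hv3⟩
    intro h
    obtain ⟨w, hw, hwv⟩ := Finset.mem_map.1 h
    exact hv2 (by rwa [← toLex.injective hwv])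
  exact absurd hle (not_le.2 hlt)

end EGH


namespace EGH

/-- move one unit from i to j -/
def mv {n : ℕ} (u : Fin n → ℕ) (i j : Fin n) : Fin n → ℕ := u - e i + e j

lemma mv_fst {n : ℕ} (u : Fin n → ℕ) {i j : Fin n} (h : i ≠ j) : mv u i j i = u i - 1 := by
  simp [mv, e_self, e_ne h]
lemma mv_snd {n : ℕ} (u : Fin n → ℕ) {i j : Fin n} (h : i ≠ j) : mv u i j j = u j + 1 := by
  simp [mv, e_self, e_ne h.symm]
lemma mv_other {n : ℕ} (u : Fin n → ℕ) {i j k : Fin n} (h : k ≠ i) (h' : k ≠ j) :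
    mv u i j k = u k := by
  simp [mv, e_ne h, e_ne h']

lemma mv_mem {n : ℕ} {a : Fin n → ℕ} {d : ℕ} {u : Fin n → ℕ} (hu : u ∈ B a d) {i j : Fin n}
    (h : i ≠ j) (hi : 0 < u i) (hj : u j + 1 < a j) : mv u i j ∈ B a d := by
  rw [mem_B] at *
  constructor
  · intro k
    have := hu.1 k
    by_cases hk : k = i
    · subst hk; rw [mv_fst u h]; omega
    · by_cases hk' : k = j
      · subst hk'; rwa [mv_snd u h]
      · rwa [mv_other u hk hk']
  · rw [mv, sum_add_e, ← sum_add_e _ i, sub_add_e hi, hu.2]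

lemma mv_llt {n : ℕ} (u : Fin n → ℕ) {i j : Fin n} (h : i < j) (hi : 0 < u i) :
    llt (mv u i j) u :=
  ⟨i, fun k hk => mv_other u hk.ne (hk.trans h).ne, by rw [mv_fst u h.ne]; omega⟩

lemma llt_mv {n : ℕ} (u : Fin n → ℕ) {i j : Fin n} (h : j < i) :
    llt u (mv u i j) :=
  ⟨j, fun k hk => (mv_other u (hk.trans h).ne hk.ne).symm, by rw [mv_snd u h.ne']; omega⟩

lemma llt_zero_le {n : ℕ} {u v : Fin (n+1) → ℕ} (h : llt u v) : u 0 ≤ v 0 := by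
  obtain ⟨p, hp, hpl⟩ := h
  by_cases h0 : p = 0
  · subst h0; exact hpl.le
  · exact (hp 0 (Fin.pos_of_ne_zero h0)).le

lemma llt_of_zero {n : ℕ} {u v : Fin (n+1) → ℕ} (h : u 0 < v 0) : llt u v :=
  ⟨0, fun k hk => absurd hk (Fin.not_lt_zero k), h⟩

lemma low {n : ℕ} {a : Fin (n+3) → ℕ} {d : ℕ} {A : Finset (Fin (n+3) → ℕ)} (hA : A ⊆ B a d)
    (hst : Stable a d A) {x : Fin (n+3) → ℕ} (hx : x ∈ A) (hx0 : x (Fin.last _) = 0) :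
    ∀ z ∈ B a d, llt z x → z ∈ A := by
  classical
  by_contra hcon
  push Not at hcon
  obtain ⟨z0, hz0, hz0x, hz0A⟩ := hcon
  obtain ⟨y, hy, hmax⟩ := Finset.exists_max_image
    ((B a d).filter (fun z => llt z x ∧ z ∉ A)) (fun z => toLex z) ⟨z0, by simp [hz0, hz0x, hz0A]⟩
  simp only [Finset.mem_filter] at hy hmax
  obtain ⟨hyB, hyx, hyA⟩ := hy
  have hmax' : ∀ z ∈ B a d, llt z x → z ∉ A → ¬ llt y z :=
    fun z h1 h2 h3 h4 => absurd (hmax z ⟨h1, h2, h3⟩) (not_le.2 h4)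
  have hxb := mem_B.1 (hA hx)
  have hyb := mem_B.1 hyB
  have hne : ∀ k, y k ≠ x k := fun k hk => hyA (hst x hx y hyB hyx ⟨k, hk⟩)
  have h0 : y 0 < x 0 := lt_of_le_of_ne (llt_zero_le hyx) (hne 0)
  have hl : 0 < y (Fin.last _) := by
    have := hne (Fin.last _); omega
  have hl0 : (0 : Fin (n+3)) < Fin.last _ := Fin.last_pos
  have hmid : ∀ i, i ≠ 0 → i ≠ Fin.last _ → a i ≤ y i + 1 := by
    intro i hi0 hil
    by_contra hcon
    push Not at hcon
    have hlt : i < Fin.last _ := lt_of_le_of_ne (Fin.le_last i) hil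
    have hzB := mv_mem hyB hlt.ne' hl hcon
    have hz0 : mv y (Fin.last _) i 0 = y 0 := mv_other y hl0.ne hi0.symm
    have hyz := llt_mv y hlt
    refine hmax' _ hzB (llt_of_zero (by rw [hz0]; exact h0)) (fun hzA => ?_) hyz
    exact hyA (hst _ hzA y hyB hyz ⟨0, hz0.symm⟩)
  have h10 : (1 : Fin (n+3)) ≠ 0 := by
    intro h; have := congrArg Fin.val h; simp at this
  have h1l : (1 : Fin (n+3)) ≠ Fin.last _ := by
    intro h; have := congrArg Fin.val h; simp at this
  have hx0a := hxb.1 0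
  have hzB := mv_mem hyB hl0.ne' hl (show y 0 + 1 < a 0 by omega)
  have hyz := llt_mv y hl0
  have hzA : mv y (Fin.last _) 0 ∉ A := fun hzA =>
    hyA (hst _ hzA y hyB hyz ⟨1, (mv_other y h1l h10).symm⟩)
  rcases llt_tri (mv y (Fin.last _) 0) x with h | h | h
  · exact hmax' _ hzB h hzA hyz
  · rw [h] at hzA; exact hzA hx
  · have hz0 := mv_snd y hl0.ne'
    have hle0 := llt_zero_le h
    have hle : ∀ k, x k ≤ mv y (Fin.last _) 0 k := by
      intro k
      by_cases hk0 : k = 0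
      · subst hk0; exact hle0
      · by_cases hkl : k = Fin.last _
        · subst hkl; omega
        · rw [mv_other y hkl hk0]
          have := hmid k hk0 hkl
          have := hxb.1 k
          omega
    obtain ⟨p, hp, hpl⟩ := h
    have := Finset.sum_lt_sum (fun k _ => hle k) ⟨p, Finset.mem_univ p, hpl⟩
    rw [hxb.2, (mem_B.1 hzB).2] at this
    exact absurd this (lt_irrefl _)

lemma high {n : ℕ} {a : Fin (n+3) → ℕ} {d : ℕ} {A : Finset (Fin (n+3) → ℕ)} (hA : A ⊆ B a d)
    (hst : Stable a d A) {x : Fin (n+3) → ℕ} (hxB : x ∈ B a d) (hx : x ∉ A)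
    (hx0 : x (Fin.last _) + 1 = a (Fin.last _)) :
    ∀ z ∈ A, ¬ llt x z := by
  classical
  by_contra hcon
  push Not at hcon
  obtain ⟨z0, hz0, hz0x⟩ := hcon
  obtain ⟨y, hy, hmin⟩ := Finset.exists_min_image
    (A.filter (fun z => llt x z)) (fun z => toLex z) ⟨z0, by simp [hz0, hz0x]⟩
  simp only [Finset.mem_filter] at hy hmin
  obtain ⟨hyA, hxy⟩ := hy
  have hyB := hA hyA
  have hmin' : ∀ z ∈ A, llt x z → ¬ llt z y :=
    fun z h1 h2 h4 => absurd (hmin z ⟨h1, h2⟩) (not_le.2 h4)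
  have hxb := mem_B.1 hxB
  have hyb := mem_B.1 hyB
  have hne : ∀ k, x k ≠ y k := fun k hk => hx (hst y hyA x hxB hxy ⟨k, hk⟩)
  have h0 : x 0 < y 0 := lt_of_le_of_ne (llt_zero_le hxy) (hne 0)
  have hl : y (Fin.last _) + 1 < a (Fin.last _) := by
    have := hne (Fin.last _)
    have := hyb.1 (Fin.last _); omega
  have hl0 : (0 : Fin (n+3)) < Fin.last _ := Fin.last_pos
  have hmid : ∀ i, i ≠ 0 → i ≠ Fin.last _ → y i = 0 := by
    intro i hi0 hil
    by_contra hcon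
    have hcon : 0 < y i := by omega
    have hlt : i < Fin.last _ := lt_of_le_of_ne (Fin.le_last i) hil
    have hzB := mv_mem hyB hlt.ne hcon hl
    have hz0 : mv y i (Fin.last _) 0 = y 0 := mv_other y hi0.symm hl0.ne
    have hyz := mv_llt y hlt hcon
    exact hmin' _ (hst _ hyA _ hzB hyz ⟨0, hz0⟩) (llt_of_zero (by rw [hz0]; exact h0)) hyz
  have h10 : (1 : Fin (n+3)) ≠ 0 := by
    intro h; have := congrArg Fin.val h; simp at this
  have h1l : (1 : Fin (n+3)) ≠ Fin.last _ := by
    intro h; have := congrArg Fin.val h; simp at this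
  have hzB := mv_mem hyB hl0.ne (by omega) hl
  have hyz := mv_llt y hl0 (by omega)
  have hzA : mv y 0 (Fin.last _) ∈ A := hst _ hyA _ hzB hyz ⟨1, mv_other y h10 h1l⟩
  rcases llt_tri x (mv y 0 (Fin.last _)) with h | h | h
  · exact hmin' _ hzA h hyz
  · rw [← h] at hzA; exact hx hzA
  · have hz0 := mv_fst y hl0.ne
    have hle0 := llt_zero_le h
    have hle : ∀ k, mv y 0 (Fin.last _) k ≤ x k := by
      intro k
      by_cases hk0 : k = 0
      · subst hk0; exact hle0
      · by_cases hkl : k = Fin.last _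
        · subst hkl; have := (mem_B.1 hzB).1 (Fin.last _); omega
        · rw [mv_other y hk0 hkl]
          have := hmid k hk0 hkl
          omega
    obtain ⟨p, hp, hpl⟩ := h
    have := Finset.sum_lt_sum (fun k _ => hle k) ⟨p, Finset.mem_univ p, hpl⟩
    rw [hxb.2, (mem_B.1 hzB).2] at this
    exact absurd this (lt_irrefl _)

lemma card_sh_stable {n : ℕ} {a : Fin (n+1) → ℕ} {d : ℕ} {A : Finset (Fin (n+1) → ℕ)}
    (hA : A ⊆ B a (d+1))
    (hst : ∀ u ∈ A, ∀ i, i ≠ Fin.last _ → 0 < u i → u (Fin.last _) + 1 < a (Fin.last _) →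
      mv u i (Fin.last _) ∈ A) :
    (sh A).card = (A.filter (fun u => 0 < u (Fin.last _))).card +
      ((sh A).filter (fun w => w (Fin.last _) + 1 = a (Fin.last _))).card := by
  classical
  have hsub := sh_sub hA
  rw [← Finset.card_filter_add_card_filter_not (s := sh A) (fun w => w (Fin.last _) + 1 = a (Fin.last _)),
    add_comm]
  congr 1
  symm
  apply Finset.card_nbij' (fun u => u - e (Fin.last _)) (fun w => w + e (Fin.last _))
  · intro u hu
    simp only [Finset.coe_filter, Set.mem_ofPred_eq] at hu ⊢
    refine ⟨mem_sh.2 ⟨Fin.last _, by rw [sub_add_e hu.2]; exact hu.1⟩, ?_⟩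
    have := (mem_B.1 (hA hu.1)).1 (Fin.last _)
    have := hu.2
    simp [e_self]
    omega
  · intro w hw
    simp only [Finset.coe_filter, Set.mem_ofPred_eq] at hw ⊢
    refine ⟨?_, by simp [e_self]⟩
    obtain ⟨i, hi⟩ := mem_sh.1 hw.1
    by_cases hil : i = Fin.last _
    · rwa [hil] at hi
    · have h1 := (mem_B.1 (hsub hw.1)).1 (Fin.last _)
      have := hst _ hi i hil (by simp [e_self]) (by simp [e_ne (Ne.symm hil)]; omega)
      simpa [mv] using this
  · intro u hu
    simp only [Finset.coe_filter, Set.mem_ofPred_eq] at hu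
    exact sub_add_e hu.2
  · intro w hw
    simp

lemma stable_mv {n : ℕ} {a : Fin (n+3) → ℕ} {d : ℕ} {A : Finset (Fin (n+3) → ℕ)} (hA : A ⊆ B a d)
    (hst : Stable a d A) :
    ∀ u ∈ A, ∀ i, i ≠ Fin.last _ → 0 < u i → u (Fin.last _) + 1 < a (Fin.last _) →
      mv u i (Fin.last _) ∈ A := by
  intro u hu i hi h1 h2
  have hlt : i < Fin.last _ := lt_of_le_of_ne (Fin.le_last i) hi
  refine hst u hu _ (mv_mem (hA hu) hi h1 h2) (mv_llt u hlt h1) ?_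
  by_cases hi0 : i = 0
  · refine ⟨1, mv_other u ?_ ?_⟩
    · rw [hi0]; intro h; have := congrArg Fin.val h; simp at this
    · intro h; have := congrArg Fin.val h; simp at this
  · exact ⟨0, mv_other u (Ne.symm hi0) (Fin.last_pos).ne⟩

lemma Cs_stable {n : ℕ} (a : Fin n → ℕ) (d k : ℕ) : Stable a d (Cs a d k) :=
  fun _ hx _ hy h _ => Cs_init hx hy h

lemma CL_stable {n : ℕ} {a : Fin (n+3) → ℕ} {d : ℕ} {A : Finset (Fin (n+3) → ℕ)}
    (hA : A ⊆ B a (d+1)) (hst : Stable a (d+1) A) :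
    (sh (Cs a (d+1) A.card)).card ≤ (sh A).card := by
  have hC := Cs_sub a (d+1) A.card
  rw [card_sh_stable hA (stable_mv hA hst),
    card_sh_stable hC (stable_mv hC (Cs_stable a (d+1) A.card))]
  apply add_le_add
  · have hcard : (Cs a (d+1) A.card).card = A.card := card_Cs _ _ (Finset.card_le_card hA)
    have h1 := Finset.card_filter_add_card_filter_not (s := A) (fun u => 0 < u (Fin.last (n+2)))
    have h2 := Finset.card_filter_add_card_filter_not (s := Cs a (d+1) A.card)
      (fun u => 0 < u (Fin.last (n+2)))
    have h3 : (A.filter (fun u => ¬ 0 < u (Fin.last (n+2)))).card ≤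
        ((Cs a (d+1) A.card).filter (fun u => ¬ 0 < u (Fin.last (n+2)))).card := by
      apply Finset.card_le_card
      intro x hx
      simp only [Finset.mem_filter] at hx ⊢
      refine ⟨mem_Cs.2 ⟨hA hx.1, ?_⟩, hx.2⟩
      have hlow := low hA hst hx.1 (by omega)
      apply Finset.card_lt_card
      rw [Finset.ssubset_iff_of_subset]
      · exact ⟨x, hx.1, by simp [llt_irrefl]⟩
      · intro w hw
        simp only [Finset.mem_filter] at hw
        exact hlow w hw.1 hw.2
    have goal : ((Cs a (d+1) A.card).filter (fun u => 0 < u (Fin.last (n+2)))).card ≤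
        (A.filter (fun u => 0 < u (Fin.last (n+2)))).card := by omega
    exact goal
  · apply Finset.card_le_card
    intro w hw
    simp only [Finset.mem_filter] at hw ⊢
    refine ⟨?_, hw.2⟩
    obtain ⟨i, hi⟩ := mem_sh.1 hw.1
    have hxB := hC hi
    have hb := (mem_B.1 hxB).1 (Fin.last _)
    have hil : Fin.last (n+2) ≠ i := by
      rintro rfl
      simp [e_self] at hb
      omega
    refine mem_sh.2 ⟨i, ?_⟩
    by_contra hx
    have hhigh := high hA hst hxB hx (by simp [e_ne hil]; omega)
    have hr := (mem_Cs.1 hi).2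
    refine absurd (Finset.card_le_card ?_) (not_le.2 hr)
    intro z hz
    simp only [Finset.mem_filter]
    refine ⟨hA hz, ?_⟩
    rcases llt_tri z (w + e i) with h | h | h
    · exact h
    · rw [h] at hz; exact absurd hz hx
    · exact absurd h (hhigh z hz)

lemma eq2 {a : Fin 2 → ℕ} {d : ℕ} {u v : Fin 2 → ℕ} (hu : u ∈ B a d) (hv : v ∈ B a d)
    (h : u 0 = v 0) : u = v := by
  have h1 := (mem_B.1 hu).2
  have h2 := (mem_B.1 hv).2
  rw [Fin.sum_univ_two] at h1 h2
  funext k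
  fin_cases k
  · exact h
  · simp; omega

lemma CL_two (a : Fin 2 → ℕ) (ha : Monotone a) : CL a := by
  classical
  intro d A hA
  have ha01 : a 0 ≤ a 1 := ha (by simp)
  by_cases hAB : A = B a (d+1)
  · have : Cs a (d+1) A.card ⊆ A := by rw [hAB]; exact Cs_sub _ _ _
    exact Finset.card_le_card (sh_mono this)
  have hC := Cs_sub a (d+1) A.card
  have hCk := card_Cs_le a (d+1) A.card
  by_cases hA0 : A = ∅
  · subst hA0
    have : Cs a (d+1) (∅ : Finset (Fin 2 → ℕ)).card = ∅ := by
      rw [← Finset.card_eq_zero]; simpa using hCk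
    rw [this]
  have hbd : ∀ u ∈ B a (d+1), u 0 < a 0 ∧ u 1 < a 1 ∧ u 0 + u 1 = d + 1 := by
    intro u hu
    have := mem_B.1 hu
    rw [Fin.sum_univ_two] at this
    exact ⟨this.1 0, this.1 1, this.2⟩
  have hbd' : ∀ u ∈ B a d, u 0 < a 0 ∧ u 1 < a 1 ∧ u 0 + u 1 = d := by
    intro u hu
    have := mem_B.1 hu
    rw [Fin.sum_univ_two] at this
    exact ⟨this.1 0, this.1 1, this.2⟩
  have h01 : (0 : Fin 2) ≠ 1 := by decide
  have hup : (sh (Cs a (d+1) A.card)).card = ((Cs a (d+1) A.card).filter (fun u => 0 < u 1)).card +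
      ((sh (Cs a (d+1) A.card)).filter (fun w => w 1 + 1 = a 1)).card := by
    apply card_sh_stable (n := 1) hC
    intro u hu i hi h1 h2
    have hlt : i < Fin.last _ := lt_of_le_of_ne (Fin.le_last i) hi
    exact Cs_init hu (mv_mem (hC hu) hi h1 h2) (mv_llt u hlt h1)
  have hf1 : ((Cs a (d+1) A.card).filter (fun u => 0 < u 1)).card ≤ A.card :=
    (Finset.card_le_card (Finset.filter_subset _ _)).trans hCk
  rcases Nat.lt_or_ge (d+1) (a 1) with hd | hd
  · have hz : ((sh (Cs a (d+1) A.card)).filter (fun w => w 1 + 1 = a 1)).card = 0 := by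
      rw [Finset.card_eq_zero, Finset.filter_eq_empty_iff]
      intro w hw h
      have := hbd' w (sh_sub hC hw)
      omega
    have hex : ∃ y ∈ B a (d+1), y ∉ A := by
      by_contra hcon
      push Not at hcon
      exact hAB (Finset.Subset.antisymm hA hcon)
    obtain ⟨y, hyB, hyA⟩ := hex
    have hy := hbd y hyB
    have hlow : A.card ≤ (sh A).card := by
      apply Finset.card_le_card_of_injOn (fun u => if u 0 < y 0 then u - e 1 else u - e 0)
      · intro u hu
        have hub := hbd u (hA hu)
        have hne : u 0 ≠ y 0 := fun h => hyA (by rw [← eq2 (hA hu) hyB h]; exact hu)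
        simp only
        split_ifs with h
        · exact mem_sh.2 ⟨1, by rw [sub_add_e (by omega)]; exact hu⟩
        · exact mem_sh.2 ⟨0, by rw [sub_add_e (by omega)]; exact hu⟩
      · intro u hu v hv huv
        have hneu : u 0 ≠ y 0 := fun h => hyA (by rw [← eq2 (hA hu) hyB h]; exact hu)
        have hnev : v 0 ≠ y 0 := fun h => hyA (by rw [← eq2 (hA hv) hyB h]; exact hv)
        apply eq2 (hA hu) (hA hv)
        simp only at huv
        have := congrFun huv 0
        split_ifs at this with h1 h2 h2 <;> simp [e_self, e_ne h01] at this <;> omega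
    omega
  · have hz : ((sh (Cs a (d+1) A.card)).filter (fun w => w 1 + 1 = a 1)).card ≤ 1 := by
      rw [Finset.card_le_one]
      intro w hw v hv
      simp only [Finset.mem_filter] at hw hv
      have h1 := hbd' w (sh_sub hC hw.1)
      have h2 := hbd' v (sh_sub hC hv.1)
      exact eq2 (sh_sub hC hw.1) (sh_sub hC hv.1) (by omega)
    have hlow : A.card + 1 ≤ (sh A).card := by
      obtain ⟨m, hm, hmax⟩ := Finset.exists_max_image A (fun u => u 0) (Finset.nonempty_iff_ne_empty.2 hA0)
      have hmb := hbd m (hA hm)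
      have himg : (A.image (fun u => u - e 0)).card = A.card := by
        apply Finset.card_image_of_injOn
        intro u hu v hv huv
        have h1 := hbd u (hA hu)
        have h2 := hbd v (hA hv)
        apply eq2 (hA hu) (hA hv)
        have := congrFun huv 0
        simp [e_self] at this
        omega
      have hnm : m - e 1 ∉ A.image (fun u => u - e 0) := by
        intro h
        obtain ⟨u, hu, huv⟩ := Finset.mem_image.1 h
        have h1 := hbd u (hA hu)
        have h2 := hmax u hu
        have := congrFun huv 0
        simp [e_self, e_ne h01] at this
        omega
      rw [← himg, ← Finset.card_insert_of_notMem hnm]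
      apply Finset.card_le_card
      intro w hw
      rw [Finset.mem_insert, Finset.mem_image] at hw
      rcases hw with rfl | ⟨u, hu, rfl⟩
      · exact mem_sh.2 ⟨1, by rw [sub_add_e (by omega)]; exact hm⟩
      · have h1 := hbd u (hA hu)
        exact mem_sh.2 ⟨0, by rw [sub_add_e (by omega)]; exact hu⟩
    omega

lemma CL_small {n : ℕ} (hn : n ≤ 1) (a : Fin n → ℕ) : CL a := by
  intro d A hA
  have : Cs a (d+1) A.card = A := by
    symm
    apply init_eq hA
    intro u hu v hv _
    have : v = u := by
      have h1 := (mem_B.1 (hA hu)).2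
      have h2 := (mem_B.1 hv).2
      interval_cases n
      · exact Subsingleton.elim _ _
      · simp at h1 h2
        funext k
        rw [Subsingleton.elim k 0, h1, h2]
    rwa [this]
  rw [this]

theorem clements_lindstrom : ∀ (n : ℕ) (a : Fin n → ℕ), Monotone a → CL a
  | 0, a, _ => CL_small (by omega) a
  | 1, a, _ => CL_small (by omega) a
  | 2, a, ha => CL_two a ha
  | n+3, a, ha => by
    intro d A hA
    obtain ⟨A', hA', hc, hs, hst⟩ := exists_stable a
      (fun j => clements_lindstrom (n+2) (a ∘ j.succAbove)
        (ha.comp (Fin.strictMono_succAbove j).monotone)) d A hA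
    rw [← hc]
    exact (CL_stable hA' hst).trans hs

end EGH

namespace EGH

section
variable {K : Type*} [Field K]

theorem comp_map {n m : ℕ} (φ : MvPolynomial (Fin n) K →ₗ[K] MvPolynomial (Fin m) K) (k : ℕ)
    (hφ : ∀ e f, f.IsHomogeneous e → (φ f).IsHomogeneous (e + k)) (d : ℕ)
    (f : MvPolynomial (Fin n) K) :
    homogeneousComponent (d + k) (φ f) = φ (homogeneousComponent d f) := by
  conv_lhs => rw [← sum_homogeneousComponent f]
  rw [map_sum, map_sum]
  have : ∀ i ∈ Finset.range (f.totalDegree + 1),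
      homogeneousComponent (d + k) (φ (homogeneousComponent i f))
        = if d = i then φ (homogeneousComponent i f) else 0 := by
    intro i _
    rw [homogeneousComponent_of_mem (hφ i _ (homogeneousComponent_isHomogeneous i f))]
    simp
  rw [Finset.sum_congr rfl this, Finset.sum_ite_eq]
  split_ifs with h
  · rfl
  · rw [homogeneousComponent_eq_zero, map_zero]
    simp at h; omega

theorem comp_mul {n : ℕ} {l : MvPolynomial (Fin n) K} {k : ℕ} (hl : l.IsHomogeneous k) (d : ℕ)
    (f : MvPolynomial (Fin n) K) :
    homogeneousComponent (d + k) (l * f) = l * homogeneousComponent d f := by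
  have := comp_map (LinearMap.mulLeft K l) k (fun e f hf => by
    rw [add_comm]; exact hl.mul hf) d f
  simpa using this

theorem comp_mul_lt {n : ℕ} {l : MvPolynomial (Fin n) K} {k : ℕ} (hl : l.IsHomogeneous k) (d : ℕ)
    (hd : d < k) (f : MvPolynomial (Fin n) K) :
    homogeneousComponent d (l * f) = 0 := by
  conv_lhs => rw [← sum_homogeneousComponent f]
  rw [Finset.mul_sum, map_sum]
  apply Finset.sum_eq_zero
  intro i _
  rw [homogeneousComponent_of_mem (hl.mul (homogeneousComponent_isHomogeneous i f)), if_neg]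
  omega

abbrev V (K : Type*) [Field K] (n d : ℕ) := homogeneousSubmodule (Fin n) K d

instance {n d : ℕ} : Module.Finite K (V K n d) := by
  rw [Module.Finite.iff_fg]
  exact homogeneousSubmodule_fg (Fin n) K d

theorem hf_add {n : ℕ} (I : Ideal (MvPolynomial (Fin n) K)) (d : ℕ) :
    hilbertFn K I d + Module.finrank K ↥(Submodule.restrictScalars K I ⊓ V K n d)
      = Module.finrank K (V K n d) := by
  unfold hilbertFn
  rw [← Submodule.finrank_quotient_add_finrank (Submodule.comap (V K n d).subtype
        (Submodule.restrictScalars K I))]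
  congr 1
  rw [← Submodule.finrank_map_subtype_eq, Submodule.map_comap_subtype, inf_comm]

theorem hf_congr {n : ℕ} {I I' : Ideal (MvPolynomial (Fin n) K)} {d : ℕ}
    (h : ∀ f, f.IsHomogeneous d → (f ∈ I ↔ f ∈ I')) : hilbertFn K I d = hilbertFn K I' d := by
  have : Submodule.restrictScalars K I ⊓ V K n d = Submodule.restrictScalars K I' ⊓ V K n d := by
    ext f
    simp only [Submodule.mem_inf, Submodule.restrictScalars_mem]
    constructor
    · rintro ⟨a, b⟩; exact ⟨(h f b).1 a, b⟩
    · rintro ⟨a, b⟩; exact ⟨(h f b).2 a, b⟩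
  have h1 := hf_add I d
  have h2 := hf_add I' d
  rw [this] at h1
  omega

theorem hf_mono {n : ℕ} {I I' : Ideal (MvPolynomial (Fin n) K)} (d : ℕ)
    (h : I ≤ I') : hilbertFn K I' d ≤ hilbertFn K I d := by
  have : Submodule.restrictScalars K I ⊓ V K n d ≤ Submodule.restrictScalars K I' ⊓ V K n d :=
    inf_le_inf_right _ h
  have h1 := hf_add I d
  have h2 := hf_add I' d
  have : FiniteDimensional K ↥(Submodule.restrictScalars K I' ⊓ V K n d) :=
    Submodule.finiteDimensional_of_le (inf_le_right)
  have := Submodule.finrank_mono ‹Submodule.restrictScalars K I ⊓ V K n d ≤ _›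
  omega

/-- colon ideal -/
noncomputable def col {n : ℕ} (I : Ideal (MvPolynomial (Fin n) K)) (l : MvPolynomial (Fin n) K) :
    Ideal (MvPolynomial (Fin n) K) :=
  Submodule.comap (LinearMap.mulLeft (MvPolynomial (Fin n) K) l) I

theorem mem_col {n : ℕ} {I : Ideal (MvPolynomial (Fin n) K)} {l f : MvPolynomial (Fin n) K} :
    f ∈ col I l ↔ l * f ∈ I := Iff.rfl

theorem le_col {n : ℕ} (I : Ideal (MvPolynomial (Fin n) K)) (l : MvPolynomial (Fin n) K) :
    I ≤ col I l := fun _ hf => I.mul_mem_left l hf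

theorem col_graded {n : ℕ} {I : Ideal (MvPolynomial (Fin n) K)} (hI : IsGradedIdeal I)
    {l : MvPolynomial (Fin n) K} (hl : l.IsHomogeneous 1) : IsGradedIdeal (col I l) := by
  intro f hf d
  rw [mem_col, ← comp_mul hl]
  exact hI _ hf _

theorem sup_span_graded {n : ℕ} {I : Ideal (MvPolynomial (Fin n) K)} (hI : IsGradedIdeal I)
    {l : MvPolynomial (Fin n) K} {k : ℕ} (hl : l.IsHomogeneous k) :
    IsGradedIdeal (I ⊔ Ideal.span {l}) := by
  intro f hf d
  obtain ⟨g, hg, h, hh, rfl⟩ := Submodule.mem_sup.1 hf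
  obtain ⟨q, rfl⟩ := Ideal.mem_span_singleton.1 hh
  rw [map_add]
  refine add_mem (Ideal.mem_sup_left (hI _ hg _)) (Ideal.mem_sup_right ?_)
  by_cases hd : d < k
  · rw [comp_mul_lt hl d hd]; exact zero_mem _
  · obtain ⟨e, rfl⟩ := Nat.exists_eq_add_of_le (not_lt.1 hd)
    rw [add_comm, comp_mul hl]
    exact Ideal.mem_span_singleton.2 (dvd_mul_right _ _)

theorem hf_sup_zero {n : ℕ} {I : Ideal (MvPolynomial (Fin n) K)} (hI : IsGradedIdeal I)
    {l : MvPolynomial (Fin n) K} {k : ℕ} (hl : l.IsHomogeneous k) (d : ℕ) (hd : d < k) :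
    hilbertFn K (I ⊔ Ideal.span {l}) d = hilbertFn K I d := by
  apply hf_congr
  intro f hf
  refine ⟨fun h => ?_, fun h => Ideal.mem_sup_left h⟩
  obtain ⟨g, hg, h, hh, rfl⟩ := Submodule.mem_sup.1 h
  obtain ⟨q, rfl⟩ := Ideal.mem_span_singleton.1 hh
  have := homogeneousComponent_of_mem (m := d) hf
  rw [if_pos rfl, map_add, comp_mul_lt hl d hd, add_zero] at this
  rw [← this]
  exact hI _ hg _

theorem hf_exact {n : ℕ} {I : Ideal (MvPolynomial (Fin n) K)} (hI : IsGradedIdeal I)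
    {l : MvPolynomial (Fin n) K} (hl : l.IsHomogeneous 1) (hl0 : l ≠ 0) (e : ℕ) :
    hilbertFn K I (e + 1) = hilbertFn K (I ⊔ Ideal.span {l}) (e + 1) + hilbertFn K (col I l) e := by
  have hinj : Function.Injective (LinearMap.mulLeft K l) := fun x y h => by
    simpa [hl0] using h
  set P := Submodule.restrictScalars K I ⊓ V K n (e + 1) with hP
  set Q := (V K n e).map (LinearMap.mulLeft K l) with hQ
  have hQV : Q ≤ V K n (e + 1) := by
    rintro _ ⟨g, hg, rfl⟩
    rw [add_comm]; exact hl.mul hg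
  have h1 : P ⊔ Q = Submodule.restrictScalars K (I ⊔ Ideal.span {l}) ⊓ V K n (e + 1) := by
    apply le_antisymm
    · refine sup_le (inf_le_inf_right _ ?_) (le_inf ?_ hQV)
      · exact fun f hf => Ideal.mem_sup_left hf
      · rintro _ ⟨g, hg, rfl⟩
        exact Ideal.mem_sup_right (Ideal.mem_span_singleton.2 (dvd_mul_right _ _))
    · rintro f ⟨hf, hfV⟩
      obtain ⟨g, hg, h, hh, rfl⟩ := Submodule.mem_sup.1 hf
      obtain ⟨q, rfl⟩ := Ideal.mem_span_singleton.1 hh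
      have := homogeneousComponent_of_mem (m := e + 1) hfV
      rw [if_pos rfl, map_add, comp_mul hl] at this
      rw [← this]
      exact Submodule.add_mem_sup ⟨hI _ hg _, homogeneousComponent_isHomogeneous _ _⟩
        ⟨_, homogeneousComponent_isHomogeneous _ _, rfl⟩
  have h2 : P ⊓ Q = (Submodule.restrictScalars K (col I l) ⊓ V K n e).map
      (LinearMap.mulLeft K l) := by
    apply le_antisymm
    · rintro _ ⟨⟨h1, h2⟩, ⟨g, hg, rfl⟩⟩
      exact ⟨g, ⟨h1, hg⟩, rfl⟩
    · rintro _ ⟨g, ⟨h1, h2⟩, rfl⟩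
      exact ⟨⟨h1, hQV ⟨g, h2, rfl⟩⟩, ⟨g, h2, rfl⟩⟩
  have fP : FiniteDimensional K P := Submodule.finiteDimensional_of_le (inf_le_right)
  have fQ : FiniteDimensional K Q := Submodule.finiteDimensional_of_le hQV
  have h3 := Submodule.finrank_sup_add_finrank_inf_eq P Q
  have h4 := (Submodule.equivMapOfInjective (LinearMap.mulLeft K l) hinj
    (Submodule.restrictScalars K (col I l) ⊓ V K n e)).finrank_eq
  have h5 : Module.finrank K (V K n e) = Module.finrank K Q :=
    (Submodule.equivMapOfInjective (LinearMap.mulLeft K l) hinj (V K n e)).finrank_eq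
  rw [← h2] at h4
  rw [h1] at h3
  have h6 := hf_add I (e + 1)
  have h7 := hf_add (col I l) e
  have h8 := hf_add (I ⊔ Ideal.span {l}) (e + 1)
  rw [← hP] at h6
  omega

end
end EGH

namespace EGH

section
variable {K : Type*} [Field K]

def Cond {n : ℕ} (a : Fin n → ℕ) (I : Ideal (MvPolynomial (Fin n) K)) : Prop :=
  ∀ j : Fin n, ∀ w : Fin j → MvPolynomial (Fin n) K, (∀ i, (w i).IsHomogeneous 1) →
    ∃ L : Multiset (MvPolynomial (Fin n) K), L.card ≤ a j ∧
      (∀ ℓ ∈ L, ℓ.IsHomogeneous 1 ∧ ℓ ∉ Submodule.span K (Set.range w)) ∧ L.prod ∈ I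

theorem Cond.mono {n : ℕ} {a : Fin n → ℕ} {I I' : Ideal (MvPolynomial (Fin n) K)}
    (h : Cond a I) (hI : I ≤ I') : Cond a I' := by
  intro j w hw
  obtain ⟨L, h1, h2, h3⟩ := h j w hw
  exact ⟨L, h1, h2, hI h3⟩

theorem lin_eq {n : ℕ} {l : MvPolynomial (Fin n) K} (hl : l.IsHomogeneous 1) :
    l = ∑ i, C (coeff (Finsupp.single i 1) l) * X i := by
  have h : l ∈ homogeneousSubmodule (Fin n) K 1 := hl
  rw [homogeneousSubmodule_one_eq_span_X, Submodule.mem_span_range_iff_exists_fun] at h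
  obtain ⟨c, rfl⟩ := h
  refine Finset.sum_congr rfl fun i _ => ?_
  rw [smul_eq_C_mul]
  congr 2
  simp [coeff_sum, coeff_smul, coeff_X, Finsupp.single_left_inj]
 
theorem lin_coeff_ne {n : ℕ} {l : MvPolynomial (Fin n) K} (hl : l.IsHomogeneous 1) (h0 : l ≠ 0) :
    ∃ k, coeff (Finsupp.single k 1) l ≠ 0 := by
  by_contra h
  push Not at h
  apply h0
  rw [lin_eq hl]
  simp [h]

theorem lemR {n : ℕ} (a : Fin (n + 1) → ℕ) {I : Ideal (MvPolynomial (Fin (n + 1)) K)}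
    (hI : IsGradedIdeal I) (hC : Cond a I) {l : MvPolynomial (Fin (n + 1)) K}
    (hl : l.IsHomogeneous 1) (hl0 : l ≠ 0) :
    ∃ I' : Ideal (MvPolynomial (Fin n) K), IsGradedIdeal I' ∧
      Cond (a ∘ (0 : Fin (n + 1)).succAbove) I' ∧
      ∀ e, hilbertFn K I' e = hilbertFn K (I ⊔ Ideal.span {l}) e := by
  obtain ⟨k, hk⟩ := lin_coeff_ne hl hl0
  set c : Fin (n + 1) → K := fun i => coeff (Finsupp.single i 1) l with hc
  have hle : l = C (c k) * X k + ∑ i : Fin n, C (c (k.succAbove i)) * X (k.succAbove i) := by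
    conv_lhs => rw [lin_eq hl]
    rw [Fin.sum_univ_succAbove _ k]
  set q : MvPolynomial (Fin n) K := - (C (c k)⁻¹ * ∑ i : Fin n, C (c (k.succAbove i)) * X i) with hq
  have hqh : q.IsHomogeneous 1 := by
    refine IsHomogeneous.neg ?_
    have := (isHomogeneous_C (Fin n) (c k)⁻¹).mul (IsHomogeneous.sum Finset.univ
      (fun i : Fin n => C (c (k.succAbove i)) * X i) 1 (fun i _ => by
        simpa using (isHomogeneous_C (Fin n) (c (k.succAbove i))).mul (isHomogeneous_X K i)))
    simpa using this
  set φ : MvPolynomial (Fin (n + 1)) K →ₐ[K] MvPolynomial (Fin n) K :=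
    aeval (k.insertNth q X) with hφ
  set ψ : MvPolynomial (Fin n) K →ₐ[K] MvPolynomial (Fin (n + 1)) K := rename k.succAbove with hψ
  have hφh : ∀ e f, f.IsHomogeneous e → (φ f).IsHomogeneous e := by
    intro e f hf
    have := IsHomogeneous.aeval hf (g := k.insertNth q X) (n := 1) (fun i => by
      refine Fin.succAboveCases k ?_ (fun i => ?_) i
      · simpa using hqh
      · simpa using isHomogeneous_X K i)
    rw [one_mul] at this
    exact this
  have hψh : ∀ e f, f.IsHomogeneous e → (ψ f).IsHomogeneous e := fun e f hf =>
    hf.rename_isHomogeneous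
  have hφψ : ∀ f, φ (ψ f) = f := by
    intro f
    have : φ.comp ψ = AlgHom.id K _ := by
      ext i
      simp [hφ, hψ]
    exact DFunLike.congr_fun this f
  have hφl : φ l = 0 := by
    rw [hle]
    simp only [map_add, map_mul, map_sum, hφ, aeval_C, aeval_X, Fin.insertNth_apply_same,
      Fin.insertNth_apply_succAbove, algebraMap_eq]
    rw [hq, mul_neg, ← mul_assoc, ← C_mul, mul_inv_cancel₀ hk]
    simp
  have hX : ∀ i, ψ (φ (X i)) - X i ∈ Submodule.span K {l} := by
    intro i
    refine Fin.succAboveCases k ?_ (fun i => ?_) i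
    · rw [Submodule.mem_span_singleton]
      refine ⟨-(c k)⁻¹, ?_⟩
      rw [hle]
      simp only [hφ, hψ, aeval_X, Fin.insertNth_apply_same, hq, map_neg, map_mul, map_sum,
        rename_C, rename_X, smul_eq_C_mul, mul_add, ← mul_assoc]
      have hcc : (C (c k)⁻¹ * C (c k) : MvPolynomial (Fin (n + 1)) K) = 1 := by
        rw [← C_mul, inv_mul_cancel₀ hk, C_1]
      rw [neg_mul, hcc]
      ring
    · simp [hφ, hψ]
  have hlin : ∀ f, f.IsHomogeneous 1 → ψ (φ f) - f ∈ Submodule.span K {l} := by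
    intro f hf
    rw [lin_eq hf]
    simp only [map_sum, map_mul, ← Finset.sum_sub_distrib]
    refine Submodule.sum_mem _ fun i _ => ?_
    have h := Submodule.smul_mem _ (coeff (Finsupp.single i 1) f) (hX i)
    convert h using 1
    rw [smul_eq_C_mul, mul_sub]
    congr 2
    simp [hφ, hψ]
  have hall : ∀ f, ψ (φ f) - f ∈ Ideal.span {l} := by
    intro f
    have h : (Ideal.Quotient.mkₐ K (Ideal.span {l})).comp (ψ.comp φ)
        = Ideal.Quotient.mkₐ K (Ideal.span {l}) := by
      ext i
      simp only [AlgHom.comp_apply, Ideal.Quotient.mkₐ_eq_mk]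
      rw [Ideal.Quotient.eq]
      exact Submodule.span_le_restrictScalars K _ _ (hX i)
    have := DFunLike.congr_fun h f
    simp only [AlgHom.comp_apply, Ideal.Quotient.mkₐ_eq_mk] at this
    rwa [Ideal.Quotient.eq] at this
  have hsurj : Function.Surjective φ := fun f => ⟨_, hφψ f⟩
  have hcomp : ∀ d f, homogeneousComponent d (φ f) = φ (homogeneousComponent d f) := fun d f =>
    comp_map φ.toLinearMap 0 hφh d f
  have hmem : ∀ f, φ f ∈ I.map φ ↔ f ∈ I ⊔ Ideal.span {l} := by
    intro f
    constructor
    · intro h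
      obtain ⟨g, hg, hgf⟩ := (Ideal.mem_map_iff_of_surjective φ hsurj).1 h
      have : f = g + ((ψ (φ g) - g) - (ψ (φ f) - f)) := by rw [hgf]; ring
      rw [this]
      exact add_mem (Ideal.mem_sup_left hg) (Ideal.mem_sup_right (sub_mem (hall _) (hall _)))
    · intro h
      obtain ⟨g, hg, h, hh, rfl⟩ := Submodule.mem_sup.1 h
      obtain ⟨r, rfl⟩ := Ideal.mem_span_singleton.1 hh
      rw [map_add, map_mul, hφl, zero_mul, add_zero]
      exact Ideal.mem_map_of_mem φ hg
  refine ⟨I.map φ, ?_, ?_, ?_⟩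
  · intro f hf d
    obtain ⟨g, hg, rfl⟩ := (Ideal.mem_map_iff_of_surjective φ hsurj).1 hf
    rw [hcomp]
    exact Ideal.mem_map_of_mem φ (hI _ hg _)
  · intro j w hw
    obtain ⟨L, h1, h2, h3⟩ := hC j.succ (Fin.cons l (fun i => ψ (w i)) : Fin (j + 1) → _) (by
      intro i
      refine Fin.cases ?_ (fun i => ?_) i
      · simpa using hl
      · simpa using hψh _ _ (hw i))
    refine ⟨L.map φ, by simpa using h1, ?_, ?_⟩
    · intro ℓ hℓ
      obtain ⟨m, hm, rfl⟩ := Multiset.mem_map.1 hℓ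
      refine ⟨hφh _ _ (h2 m hm).1, fun hsp => (h2 m hm).2 ?_⟩
      have e1 : m = ψ (φ m) - (ψ (φ m) - m) := by ring
      rw [e1]
      refine sub_mem ?_ ?_
      · have := Submodule.mem_map_of_mem (f := ψ.toLinearMap) hsp
        rw [Submodule.map_span] at this
        refine Submodule.span_mono ?_ this
        rintro _ ⟨_, ⟨i, rfl⟩, rfl⟩
        exact ⟨i.succ, by simp⟩
      · refine Submodule.span_mono ?_ (hlin m (h2 m hm).1)
        rintro _ rfl
        exact ⟨(0 : Fin (j + 1)), by simp⟩
    · rw [← map_multiset_prod]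
      exact Ideal.mem_map_of_mem φ h3
  · intro e
    set r : V K (n + 1) e →ₗ[K] V K n e := φ.toLinearMap.restrict (fun f hf => hφh e f hf) with hr
    set Qm := Submodule.comap (V K n e).subtype (Submodule.restrictScalars K (I.map φ)) with hQm
    have hk : LinearMap.ker (Qm.mkQ.comp r) = Submodule.comap (V K (n+1) e).subtype
        (Submodule.restrictScalars K (I ⊔ Ideal.span {l})) := by
      ext f
      rw [LinearMap.mem_ker, LinearMap.comp_apply, Submodule.mkQ_apply,
        Submodule.Quotient.mk_eq_zero]
      exact hmem f
    have hs : Function.Surjective (Qm.mkQ.comp r) := by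
      refine (Submodule.mkQ_surjective Qm).comp ?_
      intro f
      refine ⟨⟨ψ f, hψh _ _ f.2⟩, Subtype.ext (hφψ f)⟩
    have := (LinearMap.quotKerEquivOfSurjective _ hs).finrank_eq
    rw [hk] at this
    exact this.symm

end
end EGH

namespace EGH

section
variable {K : Type*} [Field K]

theorem filt {n : ℕ} (a : Fin (n + 1) → ℕ) {I0 : Ideal (MvPolynomial (Fin (n + 1)) K)}
    (hC : Cond a I0) : ∀ (k : ℕ) (L : Multiset (MvPolynomial (Fin (n + 1)) K)), L.card = k →
    (∀ ℓ ∈ L, ℓ.IsHomogeneous 1 ∧ ℓ ≠ 0) → ∀ I : Ideal (MvPolynomial (Fin (n + 1)) K),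
    IsGradedIdeal I → I0 ≤ I → L.prod ∈ I → ∀ d : ℕ,
    ∃ Q : ℕ → Ideal (MvPolynomial (Fin n) K),
      (∀ c < k, IsGradedIdeal (Q c) ∧ Cond (a ∘ (0 : Fin (n + 1)).succAbove) (Q c)) ∧
      (∀ e, hilbertFn K I e = ∑ c ∈ Finset.range k, if c ≤ e then hilbertFn K (Q c) (e - c) else 0) ∧
      (∀ c, c + 1 < k → c ≤ d → hilbertFn K (Q (c + 1)) (d - c) ≤ hilbertFn K (Q c) (d - c)) ∧
      (0 < k → ∃ l ∈ L, ∀ e, hilbertFn K (Q 0) e = hilbertFn K (I ⊔ Ideal.span {l}) e) := by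
  classical
  intro k
  induction k with
  | zero =>
    intro L hL _ I _ _ hLI d
    rw [Multiset.card_eq_zero] at hL
    subst hL
    rw [Multiset.prod_zero] at hLI
    have : I = ⊤ := (Ideal.eq_top_iff_one I).2 hLI
    subst this
    refine ⟨fun _ => ⊤, by simp, ?_, by simp, by simp⟩
    intro e
    have h := hf_add (⊤ : Ideal (MvPolynomial (Fin (n + 1)) K)) e
    rw [Submodule.restrictScalars_top, top_inf_eq] at h
    simp
    omega
  | succ k ih =>
    intro L hL hlin I hI h0 hLI d
    have hne : L.toFinset.Nonempty := by
      rw [Multiset.toFinset_nonempty]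
      rintro rfl
      simp at hL
    obtain ⟨l, hlL, hmax⟩ := Finset.exists_max_image L.toFinset
      (fun l => hilbertFn K (I ⊔ Ideal.span {l}) d) hne
    rw [Multiset.mem_toFinset] at hlL
    obtain ⟨hl, hl0⟩ := hlin l hlL
    obtain ⟨Q0, hQ0, hQ0C, hQ0h⟩ := lemR a hI (hC.mono h0) hl hl0
    obtain ⟨Q, h1, h2, h3, h4⟩ := ih (L.erase l) (by rw [Multiset.card_erase_of_mem hlL, hL]; rfl)
      (fun ℓ hℓ => hlin ℓ (Multiset.mem_of_mem_erase hℓ)) (col I l) (col_graded hI hl)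
      (h0.trans (le_col I l)) (by rw [mem_col, Multiset.prod_erase hlL]; exact hLI) (d - 1)
    refine ⟨fun c => Nat.casesOn c Q0 Q, ?_, ?_, ?_, ?_⟩
    · intro c hc
      cases c with
      | zero => exact ⟨hQ0, hQ0C⟩
      | succ c => exact h1 c (by omega)
    · intro e
      rw [Finset.sum_range_succ']
      simp only [zero_le, if_true, Nat.sub_zero]
      change hilbertFn K I e = _ + hilbertFn K Q0 e
      rw [hQ0h]
      cases e with
      | zero => simp [hf_sup_zero hI hl 0 (by omega)]
      | succ e =>
        rw [hf_exact hI hl hl0, add_comm, h2 e]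
        congr 1
        refine Finset.sum_congr rfl fun c _ => ?_
        simp
    · intro c hc hcd
      cases c with
      | zero =>
        obtain ⟨l', hl', hh⟩ := h4 (by omega)
        change hilbertFn K (Q 0) d ≤ hilbertFn K Q0 d
        rw [hQ0h, hh]
        refine le_trans (hf_mono d (sup_le_sup_right (le_col I l) _)) (hmax l' ?_)
        rw [Multiset.mem_toFinset]
        exact Multiset.mem_of_mem_erase hl'
      | succ c =>
        have := h3 c (by omega) (by omega)
        rw [show d - 1 - c = d - (c + 1) by omega] at this
        exact this
    · intro _
      exact ⟨l, hlL, hQ0h⟩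

theorem B_zero_card (a : Fin 0 → ℕ) (I : Ideal (MvPolynomial (Fin 0) K)) (d : ℕ) :
    hilbertFn K I d ≤ (B a d).card := by
  have h := hf_add I d
  rcases Nat.eq_zero_or_pos d with rfl | hd
  · have hB : (B a 0).card ≥ 1 := by
      rw [ge_iff_le, Finset.one_le_card]
      exact ⟨0, by rw [mem_B]; simp⟩
    have : V K 0 0 ≤ Submodule.span K {1} := by
      intro f _
      rw [Submodule.mem_span_singleton]
      refine ⟨coeff 0 f, ?_⟩
      rw [smul_eq_C_mul, mul_one]
      exact (eq_C_of_isEmpty f).symm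
    have h2 := Submodule.finrank_mono this
    have h3 := finrank_span_le_card (R := K) ({1} : Set (MvPolynomial (Fin 0) K))
    simp at h3
    omega
  · have : V K 0 d = ⊥ := by
      rw [eq_bot_iff]
      intro f hf
      rw [Submodule.mem_bot]
      have h1 : f.IsHomogeneous 0 := by
        rw [eq_C_of_isEmpty f]; exact isHomogeneous_C _ _
      by_contra h0
      exact hd.ne (h1.inj_right hf h0)
    rw [this, finrank_bot] at h
    omega

theorem main_ineq : ∀ (n : ℕ) (a : Fin n → ℕ), Monotone a →
    ∀ I : Ideal (MvPolynomial (Fin n) K), IsGradedIdeal I → Cond a I → ∀ d,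
    hilbertFn K I d ≤ (B a d).card ∧
    (sh (Cs a (d + 1) (hilbertFn K I (d + 1)))).card ≤ hilbertFn K I d := by
  intro n
  induction n with
  | zero =>
    intro a _ I _ _ d
    refine ⟨B_zero_card a I d, ?_⟩
    have : sh (Cs a (d + 1) (hilbertFn K I (d + 1))) = ∅ := by
      rw [Finset.eq_empty_iff_forall_notMem]
      intro v hv
      obtain ⟨i, _⟩ := mem_sh.1 hv
      exact i.elim0
    rw [this]; simp
  | succ n ih =>
    intro a ha I hI hC
    have ha' : Monotone (a ∘ (0 : Fin (n + 1)).succAbove) :=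
      ha.comp (Fin.strictMono_succAbove 0).monotone
    obtain ⟨L, hLc, hLl, hLI⟩ := hC 0 (fun i => i.elim0) (fun i => i.elim0)
    have hLl' : ∀ ℓ ∈ L, ℓ.IsHomogeneous 1 ∧ ℓ ≠ 0 := by
      intro ℓ hℓ
      refine ⟨(hLl ℓ hℓ).1, ?_⟩
      rintro rfl
      exact (hLl 0 hℓ).2 (zero_mem _)
    have hsum : ∀ (Q : ℕ → Ideal (MvPolynomial (Fin n) K)) e,
        (∑ c ∈ Finset.range L.card, if c ≤ e then hilbertFn K (Q c) (e - c) else 0)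
        = ∑ c ∈ Finset.range (a 0), if c ≤ e then
          (if c < L.card then hilbertFn K (Q c) (e - c) else 0) else 0 := by
      intro Q e
      rw [← Finset.sum_subset (Finset.range_subset_range.2 hLc)]
      · refine Finset.sum_congr rfl fun c hc => ?_
        rw [if_pos (Finset.mem_range.1 hc)]
      · intro c _ hc
        rw [if_neg (fun h => hc (Finset.mem_range.2 h))]
        simp
    have part1 : ∀ d, hilbertFn K I d ≤ (B a d).card := by
      intro d
      obtain ⟨Q, h1, h2, -, -⟩ := filt a hC _ L rfl hLl' I hI le_rfl hLI d
      rw [h2, hsum, ← card_TT a d 0]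
      · exact Finset.card_le_card (TT_sub _ _ _ _)
      · intro c _ _
        split_ifs with hc
        · exact (ih _ ha' (Q c) (h1 c hc).1 (h1 c hc).2 (d - c)).1
        · simp
    intro d
    refine ⟨part1 d, ?_⟩
    obtain ⟨Q, h1, h2, h3, -⟩ := filt a hC _ L rfl hLl' I hI le_rfl hLI d
    set h : ℕ → ℕ := fun c => if c < L.card then hilbertFn K (Q c) (d + 1 - c) else 0 with hh
    set g : ℕ → ℕ := fun c => if c < L.card then hilbertFn K (Q c) (d - c) else 0 with hg
    have e1 : (TT a (d + 1) 0 h).card = hilbertFn K I (d + 1) := by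
      rw [h2, hsum, ← card_TT a (d + 1) 0 h]
      intro c _ _
      simp only [hh]
      split_ifs with hc
      · exact (ih _ ha' (Q c) (h1 c hc).1 (h1 c hc).2 (d + 1 - c)).1
      · simp
    rw [← e1]
    refine (clements_lindstrom _ a ha d _ (TT_sub _ _ _ _)).trans ?_
    rw [h2 d, hsum]
    refine card_sh_TT a d 0 h g ?_ ?_
    · intro c _ hcd
      simp only [hh, hg]
      split_ifs with hc
      · rw [show d + 1 - c = d - c + 1 by omega]
        exact (ih _ ha' (Q c) (h1 c hc).1 (h1 c hc).2 (d - c)).2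
      · have : Cs (a ∘ (0 : Fin (n + 1)).succAbove) (d - c + 1) 0 = ∅ := by
          have := card_Cs_le (a ∘ (0 : Fin (n + 1)).succAbove) (d - c + 1) 0
          simpa using this
        rw [this]
        rw [Nat.le_zero, Finset.card_eq_zero, Finset.eq_empty_iff_forall_notMem]
        intro v hv
        obtain ⟨i, hi⟩ := mem_sh.1 hv
        simp at hi
    · intro c _ hcd
      simp only [hh, hg]
      split_ifs with hc hc'
      · have := h3 c hc hcd
        rwa [show d + 1 - (c + 1) = d - c by omega]
      · omega
      · simp
      · simp

end
end EGH

namespace EGH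

theorem reg_len {R : Type*} [CommRing R] [IsNoetherianRing R] (rs : List R)
    (hreg : RingTheory.Sequence.IsWeaklyRegular R rs) (j : ℕ) (w : Fin j → R)
    (hw : Ideal.span (Set.range w) ≠ ⊤) (hrs : ∀ r ∈ rs, r ∈ Ideal.span (Set.range w)) :
    rs.length ≤ j := by
  classical
  obtain ⟨p, hp⟩ := Ideal.nonempty_minimalPrimes hw
  have hpp : p.IsPrime := hp.1.1
  have hle : Ideal.span (Set.range w) ≤ p := hp.1.2
  have hh := Ideal.height_le_card_of_mem_minimalPrimes_span (Set.finite_range w) hp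
  have hcard : (Set.range w).ncard ≤ j := by
    rw [← Set.image_univ]
    refine (Set.ncard_image_le Set.finite_univ).trans ?_
    simp [Set.ncard_univ]
  have hR := hreg.isRegular_of_isLocalization_of_mem (Localization.AtPrime p) p
    (fun r hr => hle (hrs r hr))
  have hN : IsNoetherianRing (Localization.AtPrime p) :=
    IsLocalization.isNoetherianRing p.primeCompl _ inferInstance
  have hdim := ringKrullDim_add_length_eq_ringKrullDim_of_isRegular _ hR
  rw [IsLocalization.AtPrime.ringKrullDim_eq_height p (Localization.AtPrime p), List.length_map] at hdim
  have hnt : Nontrivial (Localization.AtPrime p ⧸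
      Ideal.ofList (rs.map (algebraMap R (Localization.AtPrime p)))) := by
    rw [Ideal.Quotient.nontrivial_iff]
    intro h
    apply hR.2
    rw [h]; simp
  have h0 : (0 : WithBot ℕ∞) ≤ ringKrullDim (Localization.AtPrime p ⧸
      Ideal.ofList (rs.map (algebraMap R (Localization.AtPrime p)))) :=
    ringKrullDim_nonneg_of_nontrivial
  have h1 : ((rs.length : ℕ∞) : WithBot ℕ∞) ≤ (p.height : WithBot ℕ∞) := by
    rw [← hdim]
    exact le_add_of_nonneg_left h0
  have h2 : (rs.length : ℕ∞) ≤ p.height := WithBot.coe_le_coe.1 h1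
  have h3 : (rs.length : ℕ∞) ≤ ((Set.range w).ncard : ℕ∞) := h2.trans hh
  have h4 : rs.length ≤ (Set.range w).ncard := by exact_mod_cast h3
  exact h4.trans hcard

section
variable {K : Type*} [Field K]

theorem span_comp {n : ℕ} {ι : Type*} {g : ι → MvPolynomial (Fin n) K} {N : ℕ}
    (hg : ∀ i, (g i).IsHomogeneous N) {f : MvPolynomial (Fin n) K}
    (hf : f ∈ Ideal.span (Set.range g)) (d : ℕ) :
    homogeneousComponent d f ∈ Ideal.span (Set.range g) ∧
      (d < N → homogeneousComponent d f = 0) := by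
  refine Submodule.closure_induction (p := fun f _ => homogeneousComponent d f ∈
    Ideal.span (Set.range g) ∧ (d < N → homogeneousComponent d f = 0)) ?_ ?_ ?_ hf
  · simp
  · rintro x y _ _ ⟨hx, hx'⟩ ⟨hy, hy'⟩
    rw [map_add]
    exact ⟨add_mem hx hy, fun h => by rw [hx' h, hy' h, add_zero]⟩
  · rintro r _ ⟨i, rfl⟩
    rw [smul_eq_mul, mul_comm]
    refine ⟨?_, fun h => comp_mul_lt (hg i) d h r⟩
    by_cases hd : d < N
    · rw [comp_mul_lt (hg i) d hd]; exact zero_mem _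
    · obtain ⟨e, rfl⟩ := Nat.exists_eq_add_of_le (not_lt.1 hd)
      rw [add_comm N, comp_mul (hg i)]
      exact Ideal.mul_mem_right _ _ (Ideal.subset_span ⟨i, rfl⟩)

theorem sup_range_graded {n : ℕ} {ι : Type*} {g : ι → MvPolynomial (Fin n) K} {N : ℕ}
    (hg : ∀ i, (g i).IsHomogeneous N) {I : Ideal (MvPolynomial (Fin n) K)}
    (hI : IsGradedIdeal I) : IsGradedIdeal (I ⊔ Ideal.span (Set.range g)) := by
  intro f hf d
  obtain ⟨x, hx, y, hy, rfl⟩ := Submodule.mem_sup.1 hf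
  rw [map_add]
  exact add_mem (Ideal.mem_sup_left (hI _ hx _)) (Ideal.mem_sup_right (span_comp hg hy d).1)

theorem hf_sup_range {n : ℕ} {ι : Type*} {g : ι → MvPolynomial (Fin n) K} {N : ℕ}
    (hg : ∀ i, (g i).IsHomogeneous N) {I : Ideal (MvPolynomial (Fin n) K)}
    (hI : IsGradedIdeal I) (d : ℕ) (hd : d < N) :
    hilbertFn K (I ⊔ Ideal.span (Set.range g)) d = hilbertFn K I d := by
  apply hf_congr
  intro f hf
  refine ⟨fun h => ?_, fun h => Ideal.mem_sup_left h⟩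
  obtain ⟨x, hx, y, hy, rfl⟩ := Submodule.mem_sup.1 h
  have := homogeneousComponent_of_mem (m := d) hf
  rw [if_pos rfl, map_add, (span_comp hg hy d).2 hd, add_zero] at this
  rw [← this]
  exact hI _ hx _

theorem exists_gen {n t : ℕ} {G : Set (MvPolynomial (Fin n) K)}
    (hG : ∀ g ∈ G, ∃ (k : ℕ) (ℓ : Fin k → MvPolynomial (Fin n) K),
      (∀ i, (ℓ i).IsHomogeneous 1) ∧ g = ∏ i, ℓ i)
    (a : Fin t → ℕ) (ha : Monotone a) (f : Fin t → MvPolynomial (Fin n) K)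
    (hfM : ∀ i, f i ∈ Ideal.span G) (hfhom : ∀ i, (f i).IsHomogeneous (a i))
    (hfreg : RingTheory.Sequence.IsRegular (MvPolynomial (Fin n) K) (List.ofFn f))
    (j : Fin t) (w : Fin j → MvPolynomial (Fin n) K) (hw : ∀ i, (w i).IsHomogeneous 1) :
    ∃ (k : ℕ) (ℓ : Fin k → MvPolynomial (Fin n) K), k ≤ a j ∧ 
      (∀ i, (ℓ i).IsHomogeneous 1 ∧ ℓ i ∉ Submodule.span K (Set.range w)) ∧
      ∏ i, ℓ i ∈ Ideal.span G := by
  by_contra hcon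
  push Not at hcon
  have key : ∀ x ∈ Ideal.span G, ∀ d ≤ a j,
      homogeneousComponent d x ∈ Ideal.span (Set.range w) := by
    intro x hx
    refine Submodule.closure_induction (p := fun x _ => ∀ d ≤ a j,
      homogeneousComponent d x ∈ Ideal.span (Set.range w)) ?_ ?_ ?_ hx
    · simp
    · intro x y _ _ hx hy d hd
      rw [map_add]
      exact add_mem (hx d hd) (hy d hd)
    · intro r g hg d hd
      obtain ⟨k, ℓ, hℓ, rfl⟩ := hG g hg
      have hgh : (∏ i, ℓ i).IsHomogeneous k := by
        simpa using IsHomogeneous.prod Finset.univ ℓ (fun _ => 1) (fun i _ => hℓ i)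
      rw [smul_eq_mul, mul_comm]
      by_cases hk : k ≤ a j
      · have h1 : ∃ i, ℓ i ∈ Submodule.span K (Set.range w) := by
          by_contra hne
          push Not at hne
          exact hcon k ℓ hk (fun i => ⟨hℓ i, hne i⟩) (Ideal.subset_span hg)
        obtain ⟨i, hi⟩ := h1
        refine (span_comp hw (Ideal.mul_mem_right _ _ ?_) d).1
        refine Ideal.mem_of_dvd _ (Finset.dvd_prod_of_mem ℓ (Finset.mem_univ i)) ?_
        exact Submodule.span_le_restrictScalars K _ _ hi
      · rw [comp_mul_lt hgh d (by omega)]; exact zero_mem _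
  have hmem : ∀ i : Fin t, i ≤ j → f i ∈ Ideal.span (Set.range w) := by
    intro i hij
    have := key (f i) (hfM i) (a i) (ha hij)
    rwa [homogeneousComponent_of_mem (hfhom i), if_pos rfl] at this
  have hne : Ideal.span (Set.range w) ≠ ⊤ := by
    rw [Ideal.ne_top_iff_one]
    intro h1
    have := (span_comp hw h1 0).2 (by omega)
    rw [homogeneousComponent_of_mem (isHomogeneous_one (Fin n) K), if_pos rfl] at this
    exact one_ne_zero this
  have hsplit := List.take_append_drop (j + 1) (List.ofFn f)
  have hwr := hfreg.1
  rw [← hsplit, RingTheory.Sequence.isWeaklyRegular_append_iff] at hwr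
  have hlen := reg_len _ hwr.1 j w hne (by
    intro r hr
    obtain ⟨i, hi, rfl⟩ := List.mem_take_iff_getElem.1 hr
    rw [List.getElem_ofFn]
    apply hmem
    rw [Fin.le_def]
    simp
    omega)
  rw [List.length_take, List.length_ofFn] at hlen
  have := j.2
  omega

/-- extended degree vector -/
def ah {t : ℕ} (n : ℕ) (a : Fin t → ℕ) (N : ℕ) : Fin n → ℕ := fun i =>
  if h : (i : ℕ) < t then a ⟨i, h⟩ else N

theorem ah_mono {t n : ℕ} {a : Fin t → ℕ} (ha : Monotone a) {N : ℕ} (hN : ∀ i, a i ≤ N) :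
    Monotone (ah n a N) := by
  intro i j hij
  have hij' : (i : ℕ) ≤ j := hij
  unfold ah
  split_ifs with h1 h2
  · exact ha hij'
  · exact hN _
  · omega
  · exact le_rfl

theorem cond_ah {n t : ℕ} {G : Set (MvPolynomial (Fin n) K)}
    (hG : ∀ g ∈ G, ∃ (k : ℕ) (ℓ : Fin k → MvPolynomial (Fin n) K),
      (∀ i, (ℓ i).IsHomogeneous 1) ∧ g = ∏ i, ℓ i)
    (a : Fin t → ℕ) (ha : Monotone a) (f : Fin t → MvPolynomial (Fin n) K)
    (hfM : ∀ i, f i ∈ Ideal.span G) (hfhom : ∀ i, (f i).IsHomogeneous (a i))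
    (hfreg : RingTheory.Sequence.IsRegular (MvPolynomial (Fin n) K) (List.ofFn f))
    (I : Ideal (MvPolynomial (Fin n) K)) (hMI : Ideal.span G ≤ I) (N : ℕ) :
    Cond (ah n a N) (I ⊔ Ideal.span (Set.range fun i : Fin n =>
      (X i : MvPolynomial (Fin n) K) ^ N)) := by
  classical
  intro j w hw
  by_cases hj : (j : ℕ) < t
  · obtain ⟨k, ℓ, hk, hℓ, hp⟩ := exists_gen hG a ha f hfM hfhom hfreg ⟨j, hj⟩ w hw
    refine ⟨Multiset.map ℓ Finset.univ.val, ?_, ?_, ?_⟩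
    · simpa [ah, hj] using hk
    · intro x hx
      obtain ⟨i, _, rfl⟩ := Multiset.mem_map.1 hx
      exact hℓ i
    · exact Ideal.mem_sup_left (hMI hp)
  · have : ∃ i : Fin n, (X i : MvPolynomial (Fin n) K) ∉ Submodule.span K (Set.range w) := by
      by_contra hcon
      push Not at hcon
      have h := linearIndependent_le_span' (R := K) (X : Fin n → MvPolynomial (Fin n) K)
        (linearIndependent_X (Fin n) K) (Set.range w) (by
          rintro _ ⟨i, rfl⟩; exact hcon i)
      have h2 : Fintype.card (Set.range w) ≤ j := by
        simpa using Fintype.card_range_le w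
      rw [Cardinal.mk_fin] at h
      have h3 : n ≤ Fintype.card (Set.range w) := by exact_mod_cast h
      have := j.2
      omega
    obtain ⟨i, hi⟩ := this
    refine ⟨Multiset.replicate N (X i), by simp [ah, hj], ?_, ?_⟩
    · intro x hx
      rw [Multiset.eq_of_mem_replicate hx]
      exact ⟨isHomogeneous_X K i, hi⟩
    · rw [Multiset.prod_replicate]
      exact Ideal.mem_sup_right (Ideal.subset_span ⟨i, rfl⟩)

theorem Cs_congr {n : ℕ} {a a' : Fin n → ℕ} {d : ℕ} (h : B a d = B a' d) (k : ℕ) :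
    Cs a d k = Cs a' d k := by
  unfold Cs rk
  rw [h]

theorem B_ah {n t : ℕ} (a : Fin t → ℕ) {d N N' : ℕ} (hN : d < N) (hN' : d < N') :
    B (ah n a N) d = B (ah n a N') d := by
  ext u
  rw [mem_B, mem_B]
  refine and_congr_left fun hu => forall_congr' fun i => ?_
  have : u i ≤ d := by
    rw [← hu]; exact Finset.single_le_sum (f := u) (fun _ _ => Nat.zero_le _) (Finset.mem_univ i)
  unfold ah
  split_ifs
  · rfl
  · constructor <;> intro <;> omega

/-- The monomial ideal complementary to `L`. -/
theorem exists_mono_ideal {n : ℕ} (L : ℕ → Finset (Fin n → ℕ))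
    (hdeg : ∀ d, ∀ u ∈ L d, ∑ i, u i = d) (hsh : ∀ d, sh (L (d + 1)) ⊆ L d) :
    ∃ J : Ideal (MvPolynomial (Fin n) K), IsGradedIdeal J ∧
      (∀ u : Fin n →₀ ℕ, ⇑u ∉ L (∑ i, u i) → monomial u 1 ∈ J) ∧
      ∀ d, hilbertFn K J d = (L d).card := by
  classical
  have down : ∀ m (u v : Fin n → ℕ), u ≤ v → ∑ i, v i = ∑ i, u i + m → v ∈ L (∑ i, v i) →
      u ∈ L (∑ i, u i) := by
    intro m
    induction m with
    | zero =>
      intro u v huv hs hv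
      have : u = v := by
        have h := (Finset.sum_eq_sum_iff_of_le (s := Finset.univ) (f := u) (g := v)
          (fun i _ => huv i)).1 (by simpa using hs.symm)
        funext i; exact h i (Finset.mem_univ i)
      rwa [this]
    | succ m ih =>
      intro u v huv hs hv
      have : ∃ i, u i < v i := by
        by_contra hcon
        push Not at hcon
        have := Finset.sum_le_sum (s := Finset.univ) (fun i _ => hcon i)
        omega
      obtain ⟨i, hi⟩ := this
      have hvv : (v - e i) + e i = v := by
        funext k
        by_cases hk : k = i
        · subst hk; simp [e_self]; omega
        · simp [e_ne hk]
      have hsum := sum_add_e (v - e i) i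
      rw [hvv] at hsum
      refine ih u (v - e i) ?_ (by omega) ?_
      · intro k
        by_cases hk : k = i
        · subst hk; simp [e_self]; omega
        · simpa [e_ne hk] using huv k
      · apply hsh
        rw [mem_sh]
        refine ⟨i, ?_⟩
        rw [hvv, ← hsum]
        exact hv
  set U : Set (Fin n →₀ ℕ) := {u | ⇑u ∉ L (∑ i, u i)} with hU
  have hmem : ∀ f : MvPolynomial (Fin n) K,
      f ∈ Ideal.span ((fun s => monomial s (1 : K)) '' U) ↔
      ∀ v ∈ f.support, ⇑v ∉ L (∑ i, v i) := by
    intro f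
    rw [mem_ideal_span_monomial_image]
    refine forall₂_congr fun v hv => ?_
    constructor
    · rintro ⟨u, hu, huv⟩ hvL
      refine hu (down (∑ i, v i - ∑ i, u i) u v huv ?_ hvL)
      have := Finset.sum_le_sum (s := Finset.univ) (fun i _ => huv i)
      omega
    · intro h
      exact ⟨v, h, le_rfl⟩
  refine ⟨Ideal.span ((fun s => monomial s (1 : K)) '' U), ?_, ?_, ?_⟩
  · intro f hf d
    rw [hmem] at hf ⊢
    intro v hv
    apply hf v
    rw [mem_support_iff] at hv ⊢
    rw [coeff_homogeneousComponent] at hv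
    intro h
    simp [h] at hv
  · intro u hu
    exact Ideal.subset_span ⟨u, hu, rfl⟩
  · intro d
    set T : V K n d →ₗ[K] (L d → K) := LinearMap.pi (fun u =>
      (lcoeff K (Finsupp.equivFunOnFinite.symm u.1)).comp (V K n d).subtype) with hT
    have hTa : ∀ f u, T f u = coeff (Finsupp.equivFunOnFinite.symm u.1) f.1 := fun f u => rfl
    have hk : LinearMap.ker T = Submodule.comap (V K n d).subtype
        (Submodule.restrictScalars K (Ideal.span ((fun s => monomial s (1 : K)) '' U))) := by
      ext f
      rw [LinearMap.mem_ker, Submodule.mem_comap, Submodule.restrictScalars_mem]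
      refine Iff.trans ?_ (hmem _).symm
      constructor
      · intro h v hv hvL
        have hd : ∑ i, v i = d := by
          have := f.2 (mem_support_iff.1 hv)
          simpa [Finsupp.weight_apply, Finsupp.sum_fintype] using this
        rw [hd] at hvL
        have := congrFun h ⟨_, hvL⟩
        rw [hTa] at this
        simp at this
        exact mem_support_iff.1 hv this
      · intro h
        funext u
        rw [hTa]
        by_contra hne
        refine h _ (mem_support_iff.2 hne) ?_
        have := hdeg d u.1 u.2
        simp [this]
    have hs : Function.Surjective T := by
      intro g
      refine ⟨⟨∑ u : L d, monomial (Finsupp.equivFunOnFinite.symm u.1) (g u), ?_⟩, ?_⟩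
      · refine Submodule.sum_mem _ fun u _ => ?_
        refine isHomogeneous_monomial _ ?_
        rw [Finsupp.degree_eq_sum]
        simpa using hdeg d u.1 u.2
      · funext u
        rw [hTa]
        simp only [coeff_sum, coeff_monomial, EmbeddingLike.apply_eq_iff_eq, SetCoe.ext_iff,
          Subtype.val_inj]
        simp
    have := (LinearMap.quotKerEquivOfSurjective _ hs).finrank_eq
    rw [hk] at this
    refine this.trans ?_
    simp

end
end EGH

open EGH in
theorem egh_for_ideals_containing_totally_reducible_ideal
    {n t : ℕ} (htn : t ≤ n) (K : Type*) [Field K]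
    (M : Ideal (MvPolynomial (Fin n) K)) (hred : TotallyReducible M)
    (a : Fin t → ℕ) (ha : Monotone a)
    (f : Fin t → MvPolynomial (Fin n) K)
    (hfM : ∀ i, f i ∈ M)
    (hfhom : ∀ i, (f i).IsHomogeneous (a i))
    (hfreg : RingTheory.Sequence.IsRegular (MvPolynomial (Fin n) K) (List.ofFn f))
    (I : Ideal (MvPolynomial (Fin n) K)) (hIgr : IsGradedIdeal I) (hMI : M ≤ I) :
    ∃ J : Ideal (MvPolynomial (Fin n) K), IsGradedIdeal J ∧
      (∀ i : Fin t, (X (Fin.castLE htn i) : MvPolynomial (Fin n) K) ^ a i ∈ J) ∧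
      ∀ d : ℕ, hilbertFn K J d = hilbertFn K I d := by
  obtain ⟨G, rfl, hG⟩ := hred
  set A := ∑ i, a i with hA
  have hAle : ∀ i, a i ≤ A := fun i =>
    Finset.single_le_sum (f := a) (fun _ _ => Nat.zero_le _) (Finset.mem_univ i)
  have hXh : ∀ N, ∀ i : Fin n, ((X i : MvPolynomial (Fin n) K) ^ N).IsHomogeneous N := by
    intro N i
    simpa using (isHomogeneous_X K i).pow N
  have hmain : ∀ d N, A + d + 1 < N →
      hilbertFn K I d ≤ (B (ah n a N) d).card ∧
      (sh (Cs (ah n a N) (d + 1) (hilbertFn K I (d + 1)))).card ≤ hilbertFn K I d := by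
    intro d N hN
    have := main_ineq n (ah n a N) (ah_mono ha fun i => (hAle i).trans (by omega)) _
      (sup_range_graded (hXh N) hIgr) (cond_ah hG a ha f hfM hfhom hfreg I hMI N) d
    rwa [hf_sup_range (hXh N) hIgr d (by omega), hf_sup_range (hXh N) hIgr (d + 1) (by omega)]
      at this
  obtain ⟨J, hJ1, hJ2, hJ3⟩ := exists_mono_ideal (K := K)
    (fun d => Cs (ah n a (A + d + 2)) d (hilbertFn K I d))
    (fun d u hu => (mem_B.1 (Cs_sub _ _ _ hu)).2) (by
      intro d
      have h := Cs_sh_sub (hmain d (A + (d + 1) + 2) (by omega)).2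
      rwa [Cs_congr (B_ah a (d := d) (N := A + (d + 1) + 2) (N' := A + d + 2) (by omega)
        (by omega))] at h)
  refine ⟨J, hJ1, ?_, ?_⟩
  · intro i
    rw [X_pow_eq_monomial]
    apply hJ2
    intro h
    have := (mem_B.1 (Cs_sub _ _ _ h)).1 (Fin.castLE htn i)
    simp [ah] at this
  · intro d
    rw [hJ3]
    exact card_Cs _ _ (hmain d (A + d + 2) (by omega)).1
end
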